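/- arXiv:2510.19607 — 16 statements merged into one kernel-verified Lean document; each statement's English description precedes it below -/
import Mathlib

section
/- Let (𝔥,𝔤,t,α) be a central crossed module of Lie algebras and u a half splitting, with ρ := t∘u and ω_u as below. Suppose B : 𝔤 × 𝔤 → 𝔥 is a symmetric bilinear map with B(t(x),Y) = 0, t(B(X,Y)) = 0 and B([X,Y],Z) + B(Y,[X,Z]) = 0 for all x ∈ 𝔥, X,Y,Z ∈ 𝔤, and suppose ξ : 𝔤 × 𝔤 → 𝔥 is an alternating bilinear map with ξ(t(x),Y) = 0, t(ξ(X,Y)) = 0 and δξ(X,Y,Z) = B([X,Y],Z) − δω_u(X,Y,Z) for all x ∈ 𝔥, X,Y,Z ∈ 𝔤. Then η := ω_u + ξ − B is an infinitesimal adjustment on the crossed module, adapted to the idempotent ρ = t∘u, and its symmetric part is −B, i.e. η(X,Y) + η(Y,X) = −2·B(X,Y) for all X,Y ∈ 𝔤. -/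
/-- The Chevalley–Eilenberg differential (trivial coefficients) of a 2-cochain:
`δω(X,Y,Z) = −ω([X,Y],Z) + ω([X,Z],Y) − ω([Y,Z],X)`. -/
def ceDiff {L V : Type*} [LieRing L] [AddCommGroup V]
    (ω : L → L → V) (X Y Z : L) : V :=
  -ω ⁅X, Y⁆ Z + ω ⁅X, Z⁆ Y - ω ⁅Y, Z⁆ X

/-- The 2-cochain `ω_u` associated to a half splitting `u` of a crossed module
of Lie algebras `(𝔥, 𝔤, t, α)`. -/
def omegaU {𝔥 𝔤 : Type*} [LieRing 𝔥] [LieAlgebra ℝ 𝔥] [LieRing 𝔤] [LieAlgebra ℝ 𝔤]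
    (t : 𝔥 →ₗ[ℝ] 𝔤) (α : 𝔤 →ₗ[ℝ] 𝔥 →ₗ[ℝ] 𝔥) (u : 𝔤 →ₗ[ℝ] 𝔥) (X Y : 𝔤) : 𝔥 :=
  α X (u Y) - α Y (u X) - ⁅u X, u Y⁆ + u ⁅X - t (u X), Y - t (u Y)⁆

/-- constructive direction of Theorem 4.7: given a central crossed
module of Lie algebras, a half splitting `u`, a symmetric "Chern–Weil" datum `B` and a
correction 2-cochain `ξ` as in the hypotheses, the bilinear map `η = ω_u + ξ − B` is an
infinitesimal adjustment adapted to `ρ = t∘u`, with symmetric part `−B`. -/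
theorem statement0
    {𝔥 𝔤 : Type*} [LieRing 𝔥] [LieAlgebra ℝ 𝔥] [LieRing 𝔤] [LieAlgebra ℝ 𝔤]
    (t : 𝔥 →ₗ[ℝ] 𝔤) (ht : ∀ x y : 𝔥, t ⁅x, y⁆ = ⁅t x, t y⁆)
    (α : 𝔤 →ₗ[ℝ] 𝔥 →ₗ[ℝ] 𝔥)
    (hder : ∀ (X : 𝔤) (y z : 𝔥), α X ⁅y, z⁆ = ⁅α X y, z⁆ + ⁅y, α X z⁆)
    (hact : ∀ (X Y : 𝔤) (z : 𝔥), α ⁅X, Y⁆ z = α X (α Y z) - α Y (α X z))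
    (hequiv : ∀ (X : 𝔤) (y : 𝔥), t (α X y) = ⁅X, t y⁆)
    (hpeiffer : ∀ x y : 𝔥, α (t x) y = ⁅x, y⁆)
    (hcentral : ∀ (X : 𝔤) (a : 𝔥), t a = 0 → α X a = 0)
    (u : 𝔤 →ₗ[ℝ] 𝔥) (hu : ∀ x : 𝔥, t (u (t x)) = t x)
    (B : 𝔤 →ₗ[ℝ] 𝔤 →ₗ[ℝ] 𝔥)
    (hBsymm : ∀ X Y : 𝔤, B X Y = B Y X)
    (hBker₁ : ∀ (x : 𝔥) (Y : 𝔤), B (t x) Y = 0)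
    (hBker₂ : ∀ X Y : 𝔤, t (B X Y) = 0)
    (hBinv : ∀ X Y Z : 𝔤, B ⁅X, Y⁆ Z + B Y ⁅X, Z⁆ = 0)
    (ξ : 𝔤 →ₗ[ℝ] 𝔤 →ₗ[ℝ] 𝔥)
    (hξalt : ∀ X Y : 𝔤, ξ X Y = - ξ Y X)
    (hξker₁ : ∀ (x : 𝔥) (Y : 𝔤), ξ (t x) Y = 0)
    (hξker₂ : ∀ X Y : 𝔤, t (ξ X Y) = 0)
    (hξdiff : ∀ X Y Z : 𝔤,
      ceDiff (fun X Y => ξ X Y) X Y Z = B ⁅X, Y⁆ Z - ceDiff (omegaU t α u) X Y Z)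
    (η : 𝔤 → 𝔤 → 𝔥)
    (hη : η = fun X Y => omegaU t α u X Y + ξ X Y - B X Y) :
    (∀ X Y Z : 𝔤, η ⁅X, Y⁆ Z + η Y ⁅X, Z⁆ = η X ⁅Y, Z⁆) ∧
    (∀ (x : 𝔥) (Y : 𝔤), η (t x) Y = - α Y x) ∧
    (∀ (X : 𝔤) (y : 𝔥), η X (t y) = α X y) ∧
    (∀ X Y : 𝔤, t (η X Y) = t (u ⁅X, Y⁆)) ∧
    (∀ X Y : 𝔤, η X Y + η Y X = (-2 : ℝ) • B X Y) := by
  have hωalt : ∀ X Y : 𝔤, omegaU t α u X Y = - omegaU t α u Y X := by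
    intro X Y
    have h1 : ⁅u X, u Y⁆ = -⁅u Y, u X⁆ := (lie_skew _ _).symm
    have h2 : u ⁅X - t (u X), Y - t (u Y)⁆ = - u ⁅Y - t (u Y), X - t (u X)⁆ := by
      rw [← map_neg, lie_skew]
    unfold omegaU
    rw [h1, h2]
    abel
  have hωt : ∀ (x : 𝔥) (Y : 𝔤), omegaU t α u (t x) Y = - α Y x := by
    intro x Y
    have hk : t (x - u (t x)) = 0 := by rw [map_sub, hu, sub_self]
    have h1 : α Y x = α Y (u (t x)) := by
      have := hcentral Y _ hk
      rw [map_sub] at this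
      exact sub_eq_zero.mp this
    have h2 : α (t x) (u Y) = ⁅u (t x), u Y⁆ := by
      rw [← hpeiffer (u (t x)) (u Y), hu]
    unfold omegaU
    rw [h1, h2, hu, sub_self, zero_lie, map_zero]
    abel
  have htω : ∀ X Y : 𝔤, t (omegaU t α u X Y) = t (u ⁅X, Y⁆) := by
    intro X Y
    have e1 : t (u ⁅X, t (u Y)⁆) = ⁅X, t (u Y)⁆ := by rw [← hequiv, hu]
    have e2 : t (u ⁅Y, t (u X)⁆) = ⁅Y, t (u X)⁆ := by rw [← hequiv, hu]
    have e3 : t (u ⁅t (u X), t (u Y)⁆) = ⁅t (u X), t (u Y)⁆ := by rw [← ht, hu]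
    have e4 : ⁅t (u X), Y⁆ = -⁅Y, t (u X)⁆ := (lie_skew _ _).symm
    unfold omegaU
    simp only [map_add, map_sub, map_neg, sub_lie, lie_sub, hequiv, ht, e4, e1, e2, e3]
    abel
  have hBker : ∀ (X : 𝔤) (y : 𝔥), B X (t y) = 0 := fun X y => by rw [hBsymm, hBker₁]
  have hξker : ∀ (X : 𝔤) (y : 𝔥), ξ X (t y) = 0 := fun X y => by rw [hξalt, hξker₁, neg_zero]
  subst hη
  refine ⟨?_, ?_, ?_, ?_, ?_⟩
  · intro X Y Z
    have hd := hξdiff X Y Z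
    simp only [ceDiff] at hd
    have b1 := hBinv X Y Z
    have b2 : B ⁅X, Y⁆ Z = B X ⁅Y, Z⁆ := by
      have := hBinv Y X Z
      rw [← lie_skew, map_neg, LinearMap.neg_apply] at this
      exact neg_add_eq_zero.mp this
    simp only
    rw [hωalt Y, hξalt Y, hωalt X, hξalt X]
    linear_combination (norm := module) (-1 : ℝ) • hd - b1 - b2
  · intro x Y
    simp only [hωt, hξker₁, hBker₁]
    abel
  · intro X y
    simp only [hωalt X, hωt, hξker, hBker]
    abel
  · intro X Y
    simp only [map_add, map_sub, htω, hξker₂, hBker₂]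
    abel
  · intro X Y
    simp only
    rw [hωalt Y X, hξalt Y X, hBsymm Y X]
    module
end

section
/- Let (𝔥,𝔤,t,α) be a central crossed module of Lie algebras, u a half splitting, and η an infinitesimal adjustment. Set β := η − ω_u, and write β^s(X,Y) := (β(X,Y) + β(Y,X))/2 and β^a(X,Y) := (β(X,Y) − β(Y,X))/2. Then: (i) β(t(x),Y) = 0 and β(X,t(y)) = 0 for all x,y ∈ 𝔥 and X,Y ∈ 𝔤; (ii) β^s is ad-invariant, i.e. β^s([X,Y],Z) + β^s(Y,[X,Z]) = 0 for all X,Y,Z ∈ 𝔤; and (iii) δω_u(X,Y,Z) + δβ^a(X,Y,Z) + β^s([X,Y],Z) = 0 for all X,Y,Z ∈ 𝔤 (so the Kassel–Loday cocycle δω_u is cohomologous to the Chern–Weil cocycle of −β^s). -/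
/-- converse direction of Theorem 4.7: for a central crossed module
of Lie algebras, a half splitting `u` and an infinitesimal adjustment `η`, the difference
`β = η − ω_u` vanishes on the range of `t`, its symmetric part `β^s` is ad-invariant, and
the structure equation `δω_u + δβ^a + cw(β^s) = 0` holds. -/
theorem statement1
    {𝔥 𝔤 : Type*} [LieRing 𝔥] [LieAlgebra ℝ 𝔥] [LieRing 𝔤] [LieAlgebra ℝ 𝔤]
    (t : 𝔥 →ₗ[ℝ] 𝔤) (ht : ∀ x y : 𝔥, t ⁅x, y⁆ = ⁅t x, t y⁆)
    (α : 𝔤 →ₗ[ℝ] 𝔥 →ₗ[ℝ] 𝔥)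
    (hder : ∀ (X : 𝔤) (y z : 𝔥), α X ⁅y, z⁆ = ⁅α X y, z⁆ + ⁅y, α X z⁆)
    (hact : ∀ (X Y : 𝔤) (z : 𝔥), α ⁅X, Y⁆ z = α X (α Y z) - α Y (α X z))
    (hequiv : ∀ (X : 𝔤) (y : 𝔥), t (α X y) = ⁅X, t y⁆)
    (hpeiffer : ∀ x y : 𝔥, α (t x) y = ⁅x, y⁆)
    (hcentral : ∀ (X : 𝔤) (a : 𝔥), t a = 0 → α X a = 0)
    (u : 𝔤 →ₗ[ℝ] 𝔥) (hu : ∀ x : 𝔥, t (u (t x)) = t x)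
    (η : 𝔤 →ₗ[ℝ] 𝔤 →ₗ[ℝ] 𝔥)
    (hη₁ : ∀ X Y Z : 𝔤, η ⁅X, Y⁆ Z + η Y ⁅X, Z⁆ = η X ⁅Y, Z⁆)
    (hη₂ : ∀ (x : 𝔥) (Y : 𝔤), η (t x) Y = - α Y x)
    (hη₃ : ∀ (X : 𝔤) (y : 𝔥), η X (t y) = α X y)
    (β βs βa : 𝔤 → 𝔤 → 𝔥)
    (hβ : β = fun X Y => η X Y - omegaU t α u X Y)
    (hβs : βs = fun X Y => (2⁻¹ : ℝ) • (β X Y + β Y X))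
    (hβa : βa = fun X Y => (2⁻¹ : ℝ) • (β X Y - β Y X)) :
    (∀ (x : 𝔥) (Y : 𝔤), β (t x) Y = 0) ∧
    (∀ (X : 𝔤) (y : 𝔥), β X (t y) = 0) ∧
    (∀ X Y Z : 𝔤, βs ⁅X, Y⁆ Z + βs Y ⁅X, Z⁆ = 0) ∧
    (∀ X Y Z : 𝔤,
      ceDiff (omegaU t α u) X Y Z + ceDiff βa X Y Z + βs ⁅X, Y⁆ Z = 0) := by
  have hanti : ∀ X Y : 𝔤, omegaU t α u X Y = - omegaU t α u Y X := by
    intro X Y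
    unfold omegaU
    rw [← lie_skew (u X) (u Y), ← lie_skew (X - t (u X)) (Y - t (u Y)), map_neg]
    abel
  have hω : ∀ (x : 𝔥) (Y : 𝔤), omegaU t α u (t x) Y = - α Y x := by
    intro x Y
    have h1 : α Y (u (t x) - x) = 0 := hcentral _ _ (by rw [map_sub, hu, sub_self])
    have h2 : α Y (u (t x)) = α Y x := by rwa [map_sub, sub_eq_zero] at h1
    have h3 : ⁅u (t x), u Y⁆ = ⁅x, u Y⁆ := by
      rw [← hpeiffer, hu, hpeiffer]
    unfold omegaU
    rw [hu, sub_self, zero_lie, map_zero, h2, h3, hpeiffer]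
    abel
  have hsk : ∀ A X Y : 𝔤, η A ⁅Y, X⁆ = - η A ⁅X, Y⁆ := by
    intro A X Y
    rw [← lie_skew, map_neg]
  have hA : ∀ X Y Z : 𝔤, η ⁅X, Y⁆ Z = η X ⁅Y, Z⁆ - η Y ⁅X, Z⁆ := fun X Y Z =>
    eq_sub_of_add_eq (hη₁ X Y Z)
  subst hβ hβs hβa
  refine ⟨?_, ?_, ?_, ?_⟩
  · intro x Y
    simp only [hη₂, hω, sub_self]
  · intro X y
    simp only [hη₃, hanti X, hω, neg_neg, sub_self]
  · intro X Y Z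
    simp only []
    rw [hanti Z ⁅X, Y⁆, hanti ⁅X, Z⁆ Y, hA X Y Z, hA X Z Y, hsk X Y Z]
    module
  · intro X Y Z
    simp only [ceDiff]
    rw [hanti Z ⁅X, Y⁆, hanti Y ⁅X, Z⁆, hanti X ⁅Y, Z⁆, hA X Y Z, hA X Z Y, hA Y Z X,
      hsk X Y Z, hsk Y X Z, hsk Z X Y]
    module
end

section
/- Let (𝔥,𝔤,t,α) be a central crossed module of Lie algebras. Let ρ and ρ′ be idempotent linear maps 𝔤 → 𝔤 with range t(𝔥), and let η and η′ be infinitesimal adjustments adapted to ρ and ρ′ respectively, with equal symmetric parts: η(X,Y) + η(Y,X) = η′(X,Y) + η′(Y,X) for all X,Y ∈ 𝔤. Then there exist a linear map φ : 𝔤 → 𝔥 with φ(t(x)) = 0 for all x ∈ 𝔥, and an alternating bilinear map ξ : 𝔤 × 𝔤 → 𝔥 with ξ(t(x),Y) = 0, t(ξ(X,Y)) = 0 and δξ = 0 (i.e. ξ([X,Y],Z) − ξ([X,Z],Y) + ξ([Y,Z],X) = 0 for all X,Y,Z), such that ρ(X) − ρ′(X) = t(φ(X)) and η′(X,Y) +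 ξ(X,Y) − η(X,Y) = −φ([X,Y]) for all X,Y ∈ 𝔤. -/
/-- transitivity of the `H²`-action, Theorem 5.4(2): if `η`, `η′` are
infinitesimal adjustments of a central crossed module, adapted to idempotents `ρ`, `ρ′`
with range `t(𝔥)`, and `η`, `η′` have equal symmetric parts, then there are a linear map
`φ : 𝔤 → 𝔥` vanishing on the range of `t` and a closed alternating 2-cochain `ξ`
vanishing on the range of `t` and valued in `ker t`, with `ρ − ρ′ = t∘φ` and
`η′ + ξ − η = −φ∘[·,·]`. -/
theorem statement6
    {𝔥 𝔤 : Type*} [LieRing 𝔥] [LieAlgebra ℝ 𝔥] [LieRing 𝔤] [LieAlgebra ℝ 𝔤]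
    (t : 𝔥 →ₗ[ℝ] 𝔤) (ht : ∀ x y : 𝔥, t ⁅x, y⁆ = ⁅t x, t y⁆)
    (α : 𝔤 →ₗ[ℝ] 𝔥 →ₗ[ℝ] 𝔥)
    (hder : ∀ (X : 𝔤) (y z : 𝔥), α X ⁅y, z⁆ = ⁅α X y, z⁆ + ⁅y, α X z⁆)
    (hact : ∀ (X Y : 𝔤) (z : 𝔥), α ⁅X, Y⁆ z = α X (α Y z) - α Y (α X z))
    (hequiv : ∀ (X : 𝔤) (y : 𝔥), t (α X y) = ⁅X, t y⁆)
    (hpeiffer : ∀ x y : 𝔥, α (t x) y = ⁅x, y⁆)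
    (hcentral : ∀ (X : 𝔤) (a : 𝔥), t a = 0 → α X a = 0)
    (ρ ρ' : 𝔤 →ₗ[ℝ] 𝔤)
    (hρidem : ρ ∘ₗ ρ = ρ) (hρrange : LinearMap.range ρ = LinearMap.range t)
    (hρ'idem : ρ' ∘ₗ ρ' = ρ') (hρ'range : LinearMap.range ρ' = LinearMap.range t)
    (η η' : 𝔤 →ₗ[ℝ] 𝔤 →ₗ[ℝ] 𝔥)
    (hη₁ : ∀ X Y Z : 𝔤, η ⁅X, Y⁆ Z + η Y ⁅X, Z⁆ = η X ⁅Y, Z⁆)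
    (hη₂ : ∀ (x : 𝔥) (Y : 𝔤), η (t x) Y = - α Y x)
    (hη₃ : ∀ (X : 𝔤) (y : 𝔥), η X (t y) = α X y)
    (hηad : ∀ X Y : 𝔤, t (η X Y) = ρ ⁅X, Y⁆)
    (hη'₁ : ∀ X Y Z : 𝔤, η' ⁅X, Y⁆ Z + η' Y ⁅X, Z⁆ = η' X ⁅Y, Z⁆)
    (hη'₂ : ∀ (x : 𝔥) (Y : 𝔤), η' (t x) Y = - α Y x)
    (hη'₃ : ∀ (X : 𝔤) (y : 𝔥), η' X (t y) = α X y)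
    (hη'ad : ∀ X Y : 𝔤, t (η' X Y) = ρ' ⁅X, Y⁆)
    (hsympart : ∀ X Y : 𝔤, η X Y + η Y X = η' X Y + η' Y X) :
    ∃ (φ : 𝔤 →ₗ[ℝ] 𝔥) (ξ : 𝔤 →ₗ[ℝ] 𝔤 →ₗ[ℝ] 𝔥),
      (∀ x : 𝔥, φ (t x) = 0) ∧
      (∀ X Y : 𝔤, ξ X Y = - ξ Y X) ∧
      (∀ (x : 𝔥) (Y : 𝔤), ξ (t x) Y = 0) ∧
      (∀ X Y : 𝔤, t (ξ X Y) = 0) ∧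
      (∀ X Y Z : 𝔤, ξ ⁅X, Y⁆ Z - ξ ⁅X, Z⁆ Y + ξ ⁅Y, Z⁆ X = 0) ∧
      (∀ X : 𝔤, ρ X - ρ' X = t (φ X)) ∧
      (∀ X Y : 𝔤, η' X Y + ξ X Y - η X Y = - φ ⁅X, Y⁆) := by
  have hρt : ∀ x, ρ (t x) = t x := by
    intro x
    have hx : t x ∈ LinearMap.range ρ := by rw [hρrange]; exact ⟨x, rfl⟩
    obtain ⟨z, hz⟩ := hx
    rw [← hz]
    exact LinearMap.congr_fun hρidem z
  have hρ't : ∀ x, ρ' (t x) = t x := by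
    intro x
    have hx : t x ∈ LinearMap.range ρ' := by rw [hρ'range]; exact ⟨x, rfl⟩
    obtain ⟨z, hz⟩ := hx
    rw [← hz]
    exact LinearMap.congr_fun hρ'idem z
  obtain ⟨s, hs⟩ := t.rangeRestrict.exists_rightInverse_of_surjective t.range_rangeRestrict
  have hs' : ∀ y, t (s y) = (y : 𝔤) := by
    intro y
    exact congrArg Subtype.val (LinearMap.congr_fun hs y)
  have hmem : ∀ X, (ρ - ρ') X ∈ LinearMap.range t := by
    intro X
    rw [LinearMap.sub_apply]
    refine Submodule.sub_mem _ ?_ ?_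
    · rw [← hρrange]; exact ⟨X, rfl⟩
    · rw [← hρ'range]; exact ⟨X, rfl⟩
  obtain ⟨φ, hφt, hφ⟩ : ∃ φ : 𝔤 →ₗ[ℝ] 𝔥, (∀ x, φ (t x) = 0) ∧
      ∀ X, t (φ X) = ρ X - ρ' X := by
    refine ⟨s ∘ₗ (ρ - ρ').codRestrict _ hmem, ?_, ?_⟩
    · intro x
      have h0 : (ρ - ρ').codRestrict _ hmem (t x) = 0 := by
        apply Subtype.ext
        simp [hρt, hρ't]
      rw [LinearMap.comp_apply, h0, map_zero]
    · intro X
      rw [LinearMap.comp_apply, hs']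
      simp
  let ξ : 𝔤 →ₗ[ℝ] 𝔤 →ₗ[ℝ] 𝔥 :=
    η - η' - ((LieModule.toEnd ℝ 𝔤 𝔤 : 𝔤 →ₗ[ℝ] Module.End ℝ 𝔤)).compr₂ φ
  have hξ : ∀ X Y, ξ X Y = η X Y - η' X Y - φ ⁅X, Y⁆ := fun X Y => rfl
  have hskew : ∀ X Y, η X Y - η' X Y = - (η Y X - η' Y X) := by
    intro X Y
    have h := hsympart X Y
    rw [← sub_eq_zero] at h ⊢
    rw [← h]; abel
  refine ⟨φ, ξ, hφt, ?_, ?_, ?_, ?_, fun X => (hφ X).symm, ?_⟩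
  · intro X Y
    rw [hξ, hξ, hskew X Y, ← lie_skew X Y, map_neg]
    abel
  · intro x Y
    rw [hξ, hη₂, hη'₂, ← lie_skew, ← hequiv, map_neg, hφt]
    simp
  · intro X Y
    rw [hξ, map_sub, map_sub, hηad, hη'ad, hφ, sub_self]
  · intro X Y Z
    have h1 := hη₁ X Y Z
    have h2 := hη'₁ X Y Z
    have h3 := hskew Y ⁅X, Z⁆
    have h4 := hskew X ⁅Y, Z⁆
    have hJ : φ ⁅⁅X, Y⁆, Z⁆ - φ ⁅⁅X, Z⁆, Y⁆ + φ ⁅⁅Y, Z⁆, X⁆ = 0 := by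
      rw [← map_sub, ← map_add, lie_lie X Y Z, ← lie_skew ⁅X, Z⁆ Y, ← lie_skew ⁅Y, Z⁆ X]
      have : ⁅X, ⁅Y, Z⁆⁆ - ⁅Y, ⁅X, Z⁆⁆ - -⁅Y, ⁅X, Z⁆⁆ + -⁅X, ⁅Y, Z⁆⁆ = 0 := by abel
      rw [this, map_zero]
    rw [hξ, hξ, hξ]
    have e1 : η ⁅X, Y⁆ Z = η X ⁅Y, Z⁆ - η Y ⁅X, Z⁆ := by rw [← h1]; abel
    have e2 : η' ⁅X, Y⁆ Z = η' X ⁅Y, Z⁆ - η' Y ⁅X, Z⁆ := by rw [← h2]; abel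
    calc _ = (η X ⁅Y, Z⁆ - η' X ⁅Y, Z⁆) + (η ⁅Y, Z⁆ X - η' ⁅Y, Z⁆ X)
          - ((η Y ⁅X, Z⁆ - η' Y ⁅X, Z⁆) + (η ⁅X, Z⁆ Y - η' ⁅X, Z⁆ Y))
          - (φ ⁅⁅X, Y⁆, Z⁆ - φ ⁅⁅X, Z⁆, Y⁆ + φ ⁅⁅Y, Z⁆, X⁆) := by
            rw [e1, e2]; abel
      _ = 0 := by rw [hJ, h3, h4]; abel
  · intro X Y
    rw [hξ]; abel
end

section
/- Let (𝔥₁,𝔤₁,t₁,α₁) and (𝔥₂,𝔤₂,t₂,α₂) be central crossed modules of Lie algebras, let (𝔨,i₁,i₂,r₁,r₂) be a butterfly between them with section (q,j), inducing φ, f and λ as below, and let u₁ and u₂ be half splittings of the two crossed modules, with associated 2-cochains ω_{u₁} and ω_{u₂}. Define R : 𝔤₁ × 𝔤₁ → 𝔥₂ by R(X,Y) := ω_{u₂}(φ(X),φ(Y)) − f(ω_{u₁}(X,Y)) − λ(X,Y). Then: (i) R(t₁(y),X) = 0 for all y ∈ 𝔥₁ and X ∈ 𝔤₁; and (ii) δR(X,Y,Z)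 = δω_{u₂}(φ(X),φ(Y),φ(Z)) − f(δω_{u₁}(X,Y,Z)) for all X,Y,Z ∈ 𝔤₁, where δR and δω_{u₁} are formed with the bracket of 𝔤₁ and δω_{u₂} with the bracket of 𝔤₂. -/
theorem omegaU_sub_left {𝔥 𝔤 : Type*} [LieRing 𝔥] [LieAlgebra ℝ 𝔥] [LieRing 𝔤] [LieAlgebra ℝ 𝔤]
    (t : 𝔥 →ₗ[ℝ] 𝔤) (α : 𝔤 →ₗ[ℝ] 𝔥 →ₗ[ℝ] 𝔥) (u : 𝔤 →ₗ[ℝ] 𝔥) (X X' Y : 𝔤) :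
    omegaU t α u (X - X') Y = omegaU t α u X Y - omegaU t α u X' Y := by
  simp only [omegaU, map_sub, LinearMap.sub_apply, sub_lie, lie_sub]
  abel

theorem omegaU_t_left {𝔥 𝔤 : Type*} [LieRing 𝔥] [LieAlgebra ℝ 𝔥] [LieRing 𝔤] [LieAlgebra ℝ 𝔤]
    (t : 𝔥 →ₗ[ℝ] 𝔤) (α : 𝔤 →ₗ[ℝ] 𝔥 →ₗ[ℝ] 𝔥) (u : 𝔤 →ₗ[ℝ] 𝔥)
    (hp : ∀ x y : 𝔥, α (t x) y = ⁅x, y⁆)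
    (hc : ∀ (X : 𝔤) (a : 𝔥), t a = 0 → α X a = 0)
    (hu : ∀ x : 𝔥, t (u (t x)) = t x) (y : 𝔥) (X : 𝔤) :
    omegaU t α u (t y) X = - α X y := by
  have h1 : α X (u (t y)) = α X y := by
    have := hc X (u (t y) - y) (by rw [map_sub, hu, sub_self])
    rwa [map_sub, sub_eq_zero] at this
  have h2 : ⁅u (t y), u X⁆ = α (t y) (u X) := by rw [← hp, hu]
  simp only [omegaU, h1, h2, hu, sub_self, zero_lie, map_zero]
  abel

/-- Lemma 3.7 / Proposition 3.9: for a butterfly between central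
crossed modules of Lie algebras with a section `(q,j)` inducing `φ`, `f`, `λ`, and half
splittings `u₁`, `u₂`, the 2-cochain `R = φ*ω_{u₂} − f∘ω_{u₁} − λ` vanishes on the range
of `t₁` and satisfies `δR = φ*(δω_{u₂}) − f∘(δω_{u₁})`. -/
theorem statement7
    {𝔥₁ 𝔤₁ 𝔥₂ 𝔤₂ 𝔨 : Type*}
    [LieRing 𝔥₁] [LieAlgebra ℝ 𝔥₁] [LieRing 𝔤₁] [LieAlgebra ℝ 𝔤₁]
    [LieRing 𝔥₂] [LieAlgebra ℝ 𝔥₂] [LieRing 𝔤₂] [LieAlgebra ℝ 𝔤₂]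
    [LieRing 𝔨] [LieAlgebra ℝ 𝔨]
    -- central crossed module 1
    (t₁ : 𝔥₁ →ₗ[ℝ] 𝔤₁) (ht₁ : ∀ x y : 𝔥₁, t₁ ⁅x, y⁆ = ⁅t₁ x, t₁ y⁆)
    (α₁ : 𝔤₁ →ₗ[ℝ] 𝔥₁ →ₗ[ℝ] 𝔥₁)
    (hder₁ : ∀ (X : 𝔤₁) (y z : 𝔥₁), α₁ X ⁅y, z⁆ = ⁅α₁ X y, z⁆ + ⁅y, α₁ X z⁆)
    (hact₁ : ∀ (X Y : 𝔤₁) (z : 𝔥₁), α₁ ⁅X, Y⁆ z = α₁ X (α₁ Y z) - α₁ Y (α₁ X z))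
    (hequiv₁ : ∀ (X : 𝔤₁) (y : 𝔥₁), t₁ (α₁ X y) = ⁅X, t₁ y⁆)
    (hpeiffer₁ : ∀ x y : 𝔥₁, α₁ (t₁ x) y = ⁅x, y⁆)
    (hcentral₁ : ∀ (X : 𝔤₁) (a : 𝔥₁), t₁ a = 0 → α₁ X a = 0)
    -- central crossed module 2
    (t₂ : 𝔥₂ →ₗ[ℝ] 𝔤₂) (ht₂ : ∀ x y : 𝔥₂, t₂ ⁅x, y⁆ = ⁅t₂ x, t₂ y⁆)
    (α₂ : 𝔤₂ →ₗ[ℝ] 𝔥₂ →ₗ[ℝ] 𝔥₂)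
    (hder₂ : ∀ (X : 𝔤₂) (y z : 𝔥₂), α₂ X ⁅y, z⁆ = ⁅α₂ X y, z⁆ + ⁅y, α₂ X z⁆)
    (hact₂ : ∀ (X Y : 𝔤₂) (z : 𝔥₂), α₂ ⁅X, Y⁆ z = α₂ X (α₂ Y z) - α₂ Y (α₂ X z))
    (hequiv₂ : ∀ (X : 𝔤₂) (y : 𝔥₂), t₂ (α₂ X y) = ⁅X, t₂ y⁆)
    (hpeiffer₂ : ∀ x y : 𝔥₂, α₂ (t₂ x) y = ⁅x, y⁆)
    (hcentral₂ : ∀ (X : 𝔤₂) (a : 𝔥₂), t₂ a = 0 → α₂ X a = 0)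
    -- butterfly
    (i₁ : 𝔥₁ →ₗ[ℝ] 𝔨) (hi₁ : ∀ x y : 𝔥₁, i₁ ⁅x, y⁆ = ⁅i₁ x, i₁ y⁆)
    (i₂ : 𝔥₂ →ₗ[ℝ] 𝔨) (hi₂ : ∀ x y : 𝔥₂, i₂ ⁅x, y⁆ = ⁅i₂ x, i₂ y⁆)
    (r₁ : 𝔨 →ₗ[ℝ] 𝔤₁) (hr₁ : ∀ x y : 𝔨, r₁ ⁅x, y⁆ = ⁅r₁ x, r₁ y⁆)
    (r₂ : 𝔨 →ₗ[ℝ] 𝔤₂) (hr₂ : ∀ x y : 𝔨, r₂ ⁅x, y⁆ = ⁅r₂ x, r₂ y⁆)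
    (hri₁ : ∀ y : 𝔥₁, r₁ (i₁ y) = t₁ y)
    (hri₂ : ∀ y : 𝔥₂, r₂ (i₂ y) = t₂ y)
    (hr₂i₁ : ∀ y : 𝔥₁, r₂ (i₁ y) = 0)
    (hr₁i₂ : ∀ y : 𝔥₂, r₁ (i₂ y) = 0)
    (hi₂inj : Function.Injective i₂)
    (hr₁surj : Function.Surjective r₁)
    (hker : ∀ w : 𝔨, r₁ w = 0 ↔ ∃ y : 𝔥₂, i₂ y = w)
    (hbf₁ : ∀ (w : 𝔨) (y : 𝔥₁), i₁ (α₁ (r₁ w) y) = ⁅w, i₁ y⁆)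
    (hbf₂ : ∀ (w : 𝔨) (y : 𝔥₂), i₂ (α₂ (r₂ w) y) = ⁅w, i₂ y⁆)
    -- section of the butterfly and induced maps
    (q : 𝔤₁ →ₗ[ℝ] 𝔨) (j : 𝔨 →ₗ[ℝ] 𝔥₂)
    (hq : ∀ X : 𝔤₁, r₁ (q X) = X)
    (hqj : ∀ w : 𝔨, i₂ (j w) + q (r₁ w) = w)
    (φ : 𝔤₁ → 𝔤₂) (hφ : φ = fun X => r₂ (q X))
    (f : 𝔥₁ → 𝔥₂) (hf : f = fun y => -(j (i₁ y)))
    (lam : 𝔤₁ → 𝔤₁ → 𝔥₂) (hlam : lam = fun X Y => j ⁅q X, q Y⁆)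
    -- half splittings
    (u₁ : 𝔤₁ →ₗ[ℝ] 𝔥₁) (hu₁ : ∀ x : 𝔥₁, t₁ (u₁ (t₁ x)) = t₁ x)
    (u₂ : 𝔤₂ →ₗ[ℝ] 𝔥₂) (hu₂ : ∀ x : 𝔥₂, t₂ (u₂ (t₂ x)) = t₂ x)
    -- the 2-cochain R
    (R : 𝔤₁ → 𝔤₁ → 𝔥₂)
    (hR : R = fun X Y =>
      omegaU t₂ α₂ u₂ (φ X) (φ Y) - f (omegaU t₁ α₁ u₁ X Y) - lam X Y) :
    (∀ (y : 𝔥₁) (X : 𝔤₁), R (t₁ y) X = 0) ∧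
    (∀ X Y Z : 𝔤₁,
      ceDiff R X Y Z
        = ceDiff (omegaU t₂ α₂ u₂) (φ X) (φ Y) (φ Z)
          - f (ceDiff (omegaU t₁ α₁ u₁) X Y Z)) := by
  have hji : ∀ y, j (i₂ y) = y := fun y => by
    apply hi₂inj
    have := hqj (i₂ y)
    rwa [hr₁i₂, map_zero, add_zero] at this
  have hqr : ∀ w, q (r₁ w) = w - i₂ (j w) := fun w => eq_sub_of_add_eq' (hqj w)
  have hbr : ∀ (w : 𝔨) (X : 𝔤₁), j ⁅i₂ (j w), q X⁆ = - α₂ (r₂ (q X)) (j w) := fun w X => by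
    rw [← lie_skew, ← hbf₂, map_neg, hji]
  subst hφ hf hlam hR
  refine ⟨fun y X => ?_, fun X Y Z => ?_⟩
  · have h1 : q (t₁ y) = i₁ y - i₂ (j (i₁ y)) := by rw [← hri₁, hqr]
    have h2 : r₂ (q (t₁ y)) = t₂ (-(j (i₁ y))) := by
      rw [h1, map_sub, hr₂i₁, hri₂, map_neg, zero_sub]
    have h3 : j ⁅i₁ y, q X⁆ = - j (i₁ (α₁ X y)) := by
      have := hbf₁ (q X) y
      rw [hq] at this
      rw [this, ← lie_skew, map_neg]
    simp only [h2, omegaU_t_left t₂ α₂ u₂ hpeiffer₂ hcentral₂ hu₂,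
      omegaU_t_left t₁ α₁ u₁ hpeiffer₁ hcentral₁ hu₁]
    rw [h1, sub_lie, map_sub, h3, hbr]
    simp only [map_neg]
    abel
  · have h1 : ∀ A B : 𝔤₁, q ⁅A, B⁆ = ⁅q A, q B⁆ - i₂ (j ⁅q A, q B⁆) := fun A B => by
      rw [← hqr, hr₁, hq, hq]
    have h2 : ∀ A B : 𝔤₁, r₂ (q ⁅A, B⁆) = ⁅r₂ (q A), r₂ (q B)⁆ - t₂ (j ⁅q A, q B⁆) :=
      fun A B => by rw [h1, map_sub, hr₂, hri₂]
    have hJ : ⁅⁅q X, q Y⁆, q Z⁆ - ⁅⁅q X, q Z⁆, q Y⁆ + ⁅⁅q Y, q Z⁆, q X⁆ = 0 := by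
      rw [lie_lie (q X) (q Y), ← lie_skew (q Y) ⁅q X, q Z⁆, ← lie_skew (q X) ⁅q Y, q Z⁆]
      abel
    have hJ' := congrArg j hJ
    rw [map_add, map_sub, map_zero] at hJ'
    simp only [ceDiff, h2, omegaU_sub_left,
      omegaU_t_left t₂ α₂ u₂ hpeiffer₂ hcentral₂ hu₂]
    simp only [h1, sub_lie, map_sub, hbr, map_add, map_neg]
    rw [← sub_eq_zero, ← hJ']
    abel
end

section
/- Let (𝔥₁,𝔤₁,t₁,α₁) and (𝔥₂,𝔤₂,t₂,α₂) be crossed modules of Lie algebras and let (𝔨,i₁,i₂,r₁,r₂) be a butterfly between them. Suppose: (i) for every X ∈ 𝔨 such that r₂(X) lies in the range of t₂, the element r₁(X) lies in the range of t₁; and (ii) for every a′ ∈ 𝔥₂ with t₂(a′) = 0 there exists a ∈ 𝔥₁ with t₁(a) = 0 and i₂(a′) = −i₁(a). Then the NW–SE sequence is exact at 𝔨: every X ∈ 𝔨 with r₂(X) = 0 lies in the range of i₁. -/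
/-- key step of Lemma A.2, invertibility of butterflies: if a butterfly
between crossed modules of Lie algebras induces an injective map on `π₀` (hypothesis (i))
and a surjective map on `π₁` (hypothesis (ii)), then its NW–SE sequence is exact at `𝔨`:
every `X ∈ 𝔨` with `r₂(X) = 0` lies in the range of `i₁`. -/
theorem statement8
    {𝔥₁ 𝔤₁ 𝔥₂ 𝔤₂ 𝔨 : Type*}
    [LieRing 𝔥₁] [LieAlgebra ℝ 𝔥₁] [LieRing 𝔤₁] [LieAlgebra ℝ 𝔤₁]
    [LieRing 𝔥₂] [LieAlgebra ℝ 𝔥₂] [LieRing 𝔤₂] [LieAlgebra ℝ 𝔤₂]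
    [LieRing 𝔨] [LieAlgebra ℝ 𝔨]
    -- crossed module 1
    (t₁ : 𝔥₁ →ₗ[ℝ] 𝔤₁) (ht₁ : ∀ x y : 𝔥₁, t₁ ⁅x, y⁆ = ⁅t₁ x, t₁ y⁆)
    (α₁ : 𝔤₁ →ₗ[ℝ] 𝔥₁ →ₗ[ℝ] 𝔥₁)
    (hder₁ : ∀ (X : 𝔤₁) (y z : 𝔥₁), α₁ X ⁅y, z⁆ = ⁅α₁ X y, z⁆ + ⁅y, α₁ X z⁆)
    (hact₁ : ∀ (X Y : 𝔤₁) (z : 𝔥₁), α₁ ⁅X, Y⁆ z = α₁ X (α₁ Y z) - α₁ Y (α₁ X z))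
    (hequiv₁ : ∀ (X : 𝔤₁) (y : 𝔥₁), t₁ (α₁ X y) = ⁅X, t₁ y⁆)
    (hpeiffer₁ : ∀ x y : 𝔥₁, α₁ (t₁ x) y = ⁅x, y⁆)
    -- crossed module 2
    (t₂ : 𝔥₂ →ₗ[ℝ] 𝔤₂) (ht₂ : ∀ x y : 𝔥₂, t₂ ⁅x, y⁆ = ⁅t₂ x, t₂ y⁆)
    (α₂ : 𝔤₂ →ₗ[ℝ] 𝔥₂ →ₗ[ℝ] 𝔥₂)
    (hder₂ : ∀ (X : 𝔤₂) (y z : 𝔥₂), α₂ X ⁅y, z⁆ = ⁅α₂ X y, z⁆ + ⁅y, α₂ X z⁆)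
    (hact₂ : ∀ (X Y : 𝔤₂) (z : 𝔥₂), α₂ ⁅X, Y⁆ z = α₂ X (α₂ Y z) - α₂ Y (α₂ X z))
    (hequiv₂ : ∀ (X : 𝔤₂) (y : 𝔥₂), t₂ (α₂ X y) = ⁅X, t₂ y⁆)
    (hpeiffer₂ : ∀ x y : 𝔥₂, α₂ (t₂ x) y = ⁅x, y⁆)
    -- butterfly
    (i₁ : 𝔥₁ →ₗ[ℝ] 𝔨) (hi₁ : ∀ x y : 𝔥₁, i₁ ⁅x, y⁆ = ⁅i₁ x, i₁ y⁆)
    (i₂ : 𝔥₂ →ₗ[ℝ] 𝔨) (hi₂ : ∀ x y : 𝔥₂, i₂ ⁅x, y⁆ = ⁅i₂ x, i₂ y⁆)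
    (r₁ : 𝔨 →ₗ[ℝ] 𝔤₁) (hr₁ : ∀ x y : 𝔨, r₁ ⁅x, y⁆ = ⁅r₁ x, r₁ y⁆)
    (r₂ : 𝔨 →ₗ[ℝ] 𝔤₂) (hr₂ : ∀ x y : 𝔨, r₂ ⁅x, y⁆ = ⁅r₂ x, r₂ y⁆)
    (hri₁ : ∀ y : 𝔥₁, r₁ (i₁ y) = t₁ y)
    (hri₂ : ∀ y : 𝔥₂, r₂ (i₂ y) = t₂ y)
    (hr₂i₁ : ∀ y : 𝔥₁, r₂ (i₁ y) = 0)
    (hr₁i₂ : ∀ y : 𝔥₂, r₁ (i₂ y) = 0)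
    (hi₂inj : Function.Injective i₂)
    (hr₁surj : Function.Surjective r₁)
    (hker : ∀ w : 𝔨, r₁ w = 0 ↔ ∃ y : 𝔥₂, i₂ y = w)
    (hbf₁ : ∀ (w : 𝔨) (y : 𝔥₁), i₁ (α₁ (r₁ w) y) = ⁅w, i₁ y⁆)
    (hbf₂ : ∀ (w : 𝔨) (y : 𝔥₂), i₂ (α₂ (r₂ w) y) = ⁅w, i₂ y⁆)
    -- (i) the induced map on π₀ is injective
    (hpi0 : ∀ X : 𝔨, (∃ y : 𝔥₂, r₂ X = t₂ y) → ∃ x : 𝔥₁, r₁ X = t₁ x)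
    -- (ii) the induced map on π₁ is surjective
    (hpi1 : ∀ a' : 𝔥₂, t₂ a' = 0 → ∃ a : 𝔥₁, t₁ a = 0 ∧ i₂ a' = - i₁ a) :
    ∀ X : 𝔨, r₂ X = 0 → ∃ y : 𝔥₁, i₁ y = X := by
  intro X hX
  obtain ⟨x, hx⟩ := hpi0 X ⟨0, by rw [hX, map_zero]⟩
  obtain ⟨b, hb⟩ := (hker (X - i₁ x)).1 (by rw [map_sub, hri₁, hx, sub_self])
  obtain ⟨a, -, ha⟩ := hpi1 b (by rw [← hri₂, hb, map_sub, hX, hr₂i₁, sub_self])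
  refine ⟨x - a, ?_⟩
  rw [map_sub, sub_eq_add_neg, ← ha, hb, add_sub_cancel]
end

section
/- Let (𝔥₁,𝔤₁,t₁,α₁) and (𝔥₂,𝔤₂,t₂,α₂) be crossed modules of Lie algebras, and let φ : 𝔤₁ → 𝔤₂ and f : 𝔥₁ → 𝔥₂ be linear maps and λ : 𝔤₁ × 𝔤₁ → 𝔥₂ an alternating bilinear map satisfying: (a) t₂(f(y)) = φ(t₁(y)); (b) α₂(φ(X),f(y)) = f(α₁(X,y)) + λ(X,t₁(y)); (c) [φ(X),φ(Y)] − φ([X,Y]) = t₂(λ(X,Y)); (d) α₂(φ(X),λ(Y,Z)) + α₂(φ(Y),λ(Z,X)) + α₂(φ(Z),λ(X,Y)) = λ([X,Y],Z) − λ([X,Z],Y) + λ([Y,Z],X), for all X,Y,Z ∈ 𝔤₁ and y ∈ 𝔥₁. Define on 𝔥₂ × 𝔤₁ the bracket [(x,X),(y,Y)] := ([x,y] + α₂(φ(X),y) − α₂(φ(Y),x) + λ(X,Y), [X,Y]). Then this bracket is a Lie bracket (bilinear, alternating, satisfying the Jacobi identity), and the maps i₁(y) := (−f(y), t₁(y)),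 i₂(x) := (x,0), r₁(x,X) := X, r₂(x,X) := φ(X) + t₂(x) are Lie algebra homomorphisms making (𝔥₂ × 𝔤₁, i₁, i₂, r₁, r₂) a butterfly from (𝔥₁,𝔤₁,t₁,α₁) to (𝔥₂,𝔤₂,t₂,α₂): r₁∘i₁ = t₁, r₂∘i₂ = t₂, r₂∘i₁ = 0, r₁∘i₂ = 0, i₂ is injective, r₁ is surjective, ker r₁ = range i₂, and i₁(α₁(r₁(w),y₁)) = [w,i₁(y₁)], i₂(α₂(r₂(w),y₂)) = [w,i₂(y₂)] for all w ∈ 𝔥₂ × 𝔤₁. -/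
/-- reconstruction of butterflies from cocycle data, Lemma A.4: given
crossed modules of Lie algebras and cocycle data `(φ, f, λ)` satisfying (a)–(d), the
bracket `[(x,X),(y,Y)] = ([x,y] + α₂(φX,y) − α₂(φY,x) + λ(X,Y), [X,Y])` on `𝔥₂ × 𝔤₁` is
a Lie bracket, and the four structure maps form a butterfly from `(𝔥₁,𝔤₁,t₁,α₁)` to
`(𝔥₂,𝔤₂,t₂,α₂)`. -/
theorem statement9
    {𝔥₁ 𝔤₁ 𝔥₂ 𝔤₂ : Type*}
    [LieRing 𝔥₁] [LieAlgebra ℝ 𝔥₁] [LieRing 𝔤₁] [LieAlgebra ℝ 𝔤₁]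
    [LieRing 𝔥₂] [LieAlgebra ℝ 𝔥₂] [LieRing 𝔤₂] [LieAlgebra ℝ 𝔤₂]
    -- crossed module 1
    (t₁ : 𝔥₁ →ₗ[ℝ] 𝔤₁) (ht₁ : ∀ x y : 𝔥₁, t₁ ⁅x, y⁆ = ⁅t₁ x, t₁ y⁆)
    (α₁ : 𝔤₁ →ₗ[ℝ] 𝔥₁ →ₗ[ℝ] 𝔥₁)
    (hder₁ : ∀ (X : 𝔤₁) (y z : 𝔥₁), α₁ X ⁅y, z⁆ = ⁅α₁ X y, z⁆ + ⁅y, α₁ X z⁆)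
    (hact₁ : ∀ (X Y : 𝔤₁) (z : 𝔥₁), α₁ ⁅X, Y⁆ z = α₁ X (α₁ Y z) - α₁ Y (α₁ X z))
    (hequiv₁ : ∀ (X : 𝔤₁) (y : 𝔥₁), t₁ (α₁ X y) = ⁅X, t₁ y⁆)
    (hpeiffer₁ : ∀ x y : 𝔥₁, α₁ (t₁ x) y = ⁅x, y⁆)
    -- crossed module 2
    (t₂ : 𝔥₂ →ₗ[ℝ] 𝔤₂) (ht₂ : ∀ x y : 𝔥₂, t₂ ⁅x, y⁆ = ⁅t₂ x, t₂ y⁆)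
    (α₂ : 𝔤₂ →ₗ[ℝ] 𝔥₂ →ₗ[ℝ] 𝔥₂)
    (hder₂ : ∀ (X : 𝔤₂) (y z : 𝔥₂), α₂ X ⁅y, z⁆ = ⁅α₂ X y, z⁆ + ⁅y, α₂ X z⁆)
    (hact₂ : ∀ (X Y : 𝔤₂) (z : 𝔥₂), α₂ ⁅X, Y⁆ z = α₂ X (α₂ Y z) - α₂ Y (α₂ X z))
    (hequiv₂ : ∀ (X : 𝔤₂) (y : 𝔥₂), t₂ (α₂ X y) = ⁅X, t₂ y⁆)
    (hpeiffer₂ : ∀ x y : 𝔥₂, α₂ (t₂ x) y = ⁅x, y⁆)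
    -- cocycle data
    (φ : 𝔤₁ →ₗ[ℝ] 𝔤₂) (f : 𝔥₁ →ₗ[ℝ] 𝔥₂) (lam : 𝔤₁ →ₗ[ℝ] 𝔤₁ →ₗ[ℝ] 𝔥₂)
    (hlam_alt : ∀ X Y : 𝔤₁, lam X Y = - lam Y X)
    (ha : ∀ y : 𝔥₁, t₂ (f y) = φ (t₁ y))
    (hb : ∀ (X : 𝔤₁) (y : 𝔥₁), α₂ (φ X) (f y) = f (α₁ X y) + lam X (t₁ y))
    (hc : ∀ X Y : 𝔤₁, ⁅φ X, φ Y⁆ - φ ⁅X, Y⁆ = t₂ (lam X Y))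
    (hd : ∀ X Y Z : 𝔤₁,
      α₂ (φ X) (lam Y Z) + α₂ (φ Y) (lam Z X) + α₂ (φ Z) (lam X Y)
        = lam ⁅X, Y⁆ Z - lam ⁅X, Z⁆ Y + lam ⁅Y, Z⁆ X)
    -- the reconstructed bracket and structure maps on 𝔥₂ × 𝔤₁
    (br : 𝔥₂ × 𝔤₁ → 𝔥₂ × 𝔤₁ → 𝔥₂ × 𝔤₁)
    (hbr : br = fun p q =>
      (⁅p.1, q.1⁆ + α₂ (φ p.2) q.1 - α₂ (φ q.2) p.1 + lam p.2 q.2, ⁅p.2, q.2⁆))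
    (I₁ : 𝔥₁ → 𝔥₂ × 𝔤₁) (hI₁ : I₁ = fun y => (-(f y), t₁ y))
    (I₂ : 𝔥₂ → 𝔥₂ × 𝔤₁) (hI₂ : I₂ = fun x => (x, 0))
    (R₁ : 𝔥₂ × 𝔤₁ → 𝔤₁) (hR₁ : R₁ = fun p => p.2)
    (R₂ : 𝔥₂ × 𝔤₁ → 𝔤₂) (hR₂ : R₂ = fun p => φ p.2 + t₂ p.1) :
    -- the bracket is bilinear
    (∀ p q r : 𝔥₂ × 𝔤₁, br (p + q) r = br p r + br q r) ∧
    (∀ (c : ℝ) (p r : 𝔥₂ × 𝔤₁), br (c • p) r = c • br p r) ∧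
    (∀ p q r : 𝔥₂ × 𝔤₁, br p (q + r) = br p q + br p r) ∧
    (∀ (c : ℝ) (p q : 𝔥₂ × 𝔤₁), br p (c • q) = c • br p q) ∧
    -- alternating
    (∀ p : 𝔥₂ × 𝔤₁, br p p = 0) ∧
    -- Jacobi identity
    (∀ p q r : 𝔥₂ × 𝔤₁, br (br p q) r + br (br q r) p + br (br r p) q = 0) ∧
    -- the structure maps are Lie algebra homomorphisms
    (∀ y y' : 𝔥₁, I₁ (y + y') = I₁ y + I₁ y') ∧
    (∀ (c : ℝ) (y : 𝔥₁), I₁ (c • y) = c • I₁ y) ∧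
    (∀ y y' : 𝔥₁, I₁ ⁅y, y'⁆ = br (I₁ y) (I₁ y')) ∧
    (∀ x x' : 𝔥₂, I₂ (x + x') = I₂ x + I₂ x') ∧
    (∀ (c : ℝ) (x : 𝔥₂), I₂ (c • x) = c • I₂ x) ∧
    (∀ x x' : 𝔥₂, I₂ ⁅x, x'⁆ = br (I₂ x) (I₂ x')) ∧
    (∀ p q : 𝔥₂ × 𝔤₁, R₁ (p + q) = R₁ p + R₁ q) ∧
    (∀ (c : ℝ) (p : 𝔥₂ × 𝔤₁), R₁ (c • p) = c • R₁ p) ∧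
    (∀ p q : 𝔥₂ × 𝔤₁, R₁ (br p q) = ⁅R₁ p, R₁ q⁆) ∧
    (∀ p q : 𝔥₂ × 𝔤₁, R₂ (p + q) = R₂ p + R₂ q) ∧
    (∀ (c : ℝ) (p : 𝔥₂ × 𝔤₁), R₂ (c • p) = c • R₂ p) ∧
    (∀ p q : 𝔥₂ × 𝔤₁, R₂ (br p q) = ⁅R₂ p, R₂ q⁆) ∧
    -- butterfly conditions
    (∀ y : 𝔥₁, R₁ (I₁ y) = t₁ y) ∧
    (∀ x : 𝔥₂, R₂ (I₂ x) = t₂ x) ∧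
    (∀ y : 𝔥₁, R₂ (I₁ y) = 0) ∧
    (∀ x : 𝔥₂, R₁ (I₂ x) = 0) ∧
    Function.Injective I₂ ∧
    Function.Surjective R₁ ∧
    (∀ w : 𝔥₂ × 𝔤₁, R₁ w = 0 ↔ ∃ x : 𝔥₂, I₂ x = w) ∧
    (∀ (w : 𝔥₂ × 𝔤₁) (y : 𝔥₁), I₁ (α₁ (R₁ w) y) = br w (I₁ y)) ∧
    (∀ (w : 𝔥₂ × 𝔤₁) (y : 𝔥₂), I₂ (α₂ (R₂ w) y) = br w (I₂ y)) := by
  subst hbr hI₁ hI₂ hR₁ hR₂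

  have hself : ∀ X, lam X X = 0 := fun X => by
    have h := hlam_alt X X
    linear_combination (norm := module) (1 / 2 : ℝ) • h
  have hφ : ∀ X Y, φ ⁅X, Y⁆ = ⁅φ X, φ Y⁆ - t₂ (lam X Y) := fun X Y => by
    rw [← hc]; abel
  have hα : ∀ (X Y : 𝔤₁) (z : 𝔥₂), α₂ (φ ⁅X, Y⁆) z
      = α₂ (φ X) (α₂ (φ Y) z) - α₂ (φ Y) (α₂ (φ X) z) - ⁅lam X Y, z⁆ := fun X Y z => by
    rw [hφ, map_sub, LinearMap.sub_apply, hact₂, hpeiffer₂]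
  have hder : ∀ (X : 𝔤₂) (y z : 𝔥₂), α₂ X ⁅y, z⁆ = ⁅α₂ X y, z⁆ - ⁅α₂ X z, y⁆ := fun X y z => by
    rw [hder₂, ← lie_skew y (α₂ X z)]; abel
  have hat : ∀ (y : 𝔥₁) (x : 𝔥₂), α₂ (φ (t₁ y)) x = ⁅f y, x⁆ := fun y x => by
    rw [← ha, hpeiffer₂]
  have hjac : ∀ (x y z : 𝔥₂), ⁅⁅x, y⁆, z⁆ + ⁅⁅y, z⁆, x⁆ + ⁅⁅z, x⁆, y⁆ = 0 := by
    intro x y z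
    rw [← lie_skew, ← lie_skew ⁅y, z⁆, ← lie_skew ⁅z, x⁆]
    have := lie_jacobi x y z
    rw [← neg_eq_zero, ← this]; abel
  have hjac' : ∀ (x y z : 𝔤₁), ⁅⁅x, y⁆, z⁆ + ⁅⁅y, z⁆, x⁆ + ⁅⁅z, x⁆, y⁆ = 0 := by
    intro x y z
    rw [← lie_skew, ← lie_skew ⁅y, z⁆, ← lie_skew ⁅z, x⁆]
    have := lie_jacobi x y z
    rw [← neg_eq_zero, ← this]; abel
  refine ⟨?_, ?_, ?_, ?_, ?_, ?_, ?_, ?_, ?_, ?_, ?_, ?_, ?_, ?_, ?_, ?_, ?_, ?_, ?_, ?_, ?_, ?_,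
    ?_, ?_, ?_, ?_, ?_⟩
  · rintro ⟨x, X⟩ ⟨y, Y⟩ ⟨z, Z⟩
    ext
    · simp; abel
    · simp
  · rintro c ⟨x, X⟩ ⟨z, Z⟩
    ext
    · simp [smul_add, smul_sub]
    · simp
  · rintro ⟨x, X⟩ ⟨y, Y⟩ ⟨z, Z⟩
    ext
    · simp; abel
    · simp
  · rintro c ⟨x, X⟩ ⟨z, Z⟩
    ext
    · simp [smul_add, smul_sub]
    · simp
  · rintro ⟨x, X⟩
    ext <;> simp [hself]
  · rintro ⟨x, X⟩ ⟨y, Y⟩ ⟨z, Z⟩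
    ext
    · have h1 := hjac x y z
      have h2 := hd X Y Z
      have h3 : lam ⁅X, Z⁆ Y = - lam ⁅Z, X⁆ Y := by
        rw [← lie_skew, map_neg, LinearMap.neg_apply]
      rw [h3] at h2
      simp only [Prod.fst_add, Prod.fst_zero, add_lie, sub_lie, map_add, map_sub, hα, hder]
      linear_combination (norm := module) h1 - h2
    · exact hjac' X Y Z
  · intro y y'
    ext
    · simp; abel
    · simp
  · intro c y
    ext <;> simp
  · intro y y'
    ext
    · have h := hb (t₁ y) y'
      rw [hat, hpeiffer₁] at h
      simp only [map_neg, hat, neg_lie, lie_neg, neg_neg]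
      rw [← lie_skew (f y') (f y)] at *
      linear_combination (norm := module) h
    · exact ht₁ y y'
  · intro x x'
    ext <;> simp
  · intro c x
    ext <;> simp
  · intro x x'
    ext <;> simp
  · intro p q; rfl
  · intro c p; rfl
  · intro p q; rfl
  · intro p q
    simp; abel
  · intro c p
    simp
  · rintro ⟨x, X⟩ ⟨y, Y⟩
    simp only [map_add, map_sub, hφ, hequiv₂, ht₂, add_lie, lie_add]
    rw [← lie_skew (t₂ x) (φ Y)]
    abel
  · intro y; rfl
  · intro x; simp
  · intro y; simp [ha]
  · intro x; rfl
  · intro x x' h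
    exact congrArg Prod.fst h
  · intro X
    exact ⟨(0, X), rfl⟩
  · rintro ⟨x, X⟩
    constructor
    · intro h
      exact ⟨x, Prod.ext rfl h.symm⟩
    · rintro ⟨x', h⟩
      exact (congrArg Prod.snd h).symm
  · rintro ⟨x, X⟩ y
    ext
    · simp only [map_neg, hat, lie_neg, hb]
      rw [← lie_skew x (f y)]
      abel
    · exact hequiv₁ X y
  · rintro ⟨x, X⟩ y
    ext
    · simp [hpeiffer₂]; abel
    · simp
end

section
/- Let (𝔥₁,𝔤₁,t₁,α₁) and (𝔥₂,𝔤₂,t₂,α₂) be crossed modules of Lie algebras, let (𝔨,i₁,i₂,r₁,r₂) be a butterfly between them, and let (q,j) be a section of the butterfly with induced maps φ := r₂∘q, f := −j∘i₁ and λ(X,Y) := j([q(X),q(Y)]). Then for all X,Y,Z ∈ 𝔤₁ and y ∈ 𝔥₁: (a) t₂(f(y)) = φ(t₁(y)); (b) α₂(φ(X),f(y)) = f(α₁(X,y)) + λ(X,t₁(y)); (c) [φ(X),φ(Y)] − φ([X,Y]) = t₂(λ(X,Y)); (d) α₂(φ(X),λ(Y,Z)) + α₂(φ(Y),λ(Z,X))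 + α₂(φ(Z),λ(X,Y)) = λ([X,Y],Z) − λ([X,Z],Y) + λ([Y,Z],X). -/
/-- cocycle identities for butterflies, Appendix A: a butterfly
between crossed modules of Lie algebras, together with a section `(q,j)`, induces maps
`φ = r₂∘q`, `f = −j∘i₁` and `λ(X,Y) = j([q(X),q(Y)])` satisfying the four cocycle
identities (a)–(d). -/
theorem statement10
    {𝔥₁ 𝔤₁ 𝔥₂ 𝔤₂ 𝔨 : Type*}
    [LieRing 𝔥₁] [LieAlgebra ℝ 𝔥₁] [LieRing 𝔤₁] [LieAlgebra ℝ 𝔤₁]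
    [LieRing 𝔥₂] [LieAlgebra ℝ 𝔥₂] [LieRing 𝔤₂] [LieAlgebra ℝ 𝔤₂]
    [LieRing 𝔨] [LieAlgebra ℝ 𝔨]
    -- crossed module 1
    (t₁ : 𝔥₁ →ₗ[ℝ] 𝔤₁) (ht₁ : ∀ x y : 𝔥₁, t₁ ⁅x, y⁆ = ⁅t₁ x, t₁ y⁆)
    (α₁ : 𝔤₁ →ₗ[ℝ] 𝔥₁ →ₗ[ℝ] 𝔥₁)
    (hder₁ : ∀ (X : 𝔤₁) (y z : 𝔥₁), α₁ X ⁅y, z⁆ = ⁅α₁ X y, z⁆ + ⁅y, α₁ X z⁆)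
    (hact₁ : ∀ (X Y : 𝔤₁) (z : 𝔥₁), α₁ ⁅X, Y⁆ z = α₁ X (α₁ Y z) - α₁ Y (α₁ X z))
    (hequiv₁ : ∀ (X : 𝔤₁) (y : 𝔥₁), t₁ (α₁ X y) = ⁅X, t₁ y⁆)
    (hpeiffer₁ : ∀ x y : 𝔥₁, α₁ (t₁ x) y = ⁅x, y⁆)
    -- crossed module 2
    (t₂ : 𝔥₂ →ₗ[ℝ] 𝔤₂) (ht₂ : ∀ x y : 𝔥₂, t₂ ⁅x, y⁆ = ⁅t₂ x, t₂ y⁆)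
    (α₂ : 𝔤₂ →ₗ[ℝ] 𝔥₂ →ₗ[ℝ] 𝔥₂)
    (hder₂ : ∀ (X : 𝔤₂) (y z : 𝔥₂), α₂ X ⁅y, z⁆ = ⁅α₂ X y, z⁆ + ⁅y, α₂ X z⁆)
    (hact₂ : ∀ (X Y : 𝔤₂) (z : 𝔥₂), α₂ ⁅X, Y⁆ z = α₂ X (α₂ Y z) - α₂ Y (α₂ X z))
    (hequiv₂ : ∀ (X : 𝔤₂) (y : 𝔥₂), t₂ (α₂ X y) = ⁅X, t₂ y⁆)
    (hpeiffer₂ : ∀ x y : 𝔥₂, α₂ (t₂ x) y = ⁅x, y⁆)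
    -- butterfly
    (i₁ : 𝔥₁ →ₗ[ℝ] 𝔨) (hi₁ : ∀ x y : 𝔥₁, i₁ ⁅x, y⁆ = ⁅i₁ x, i₁ y⁆)
    (i₂ : 𝔥₂ →ₗ[ℝ] 𝔨) (hi₂ : ∀ x y : 𝔥₂, i₂ ⁅x, y⁆ = ⁅i₂ x, i₂ y⁆)
    (r₁ : 𝔨 →ₗ[ℝ] 𝔤₁) (hr₁ : ∀ x y : 𝔨, r₁ ⁅x, y⁆ = ⁅r₁ x, r₁ y⁆)
    (r₂ : 𝔨 →ₗ[ℝ] 𝔤₂) (hr₂ : ∀ x y : 𝔨, r₂ ⁅x, y⁆ = ⁅r₂ x, r₂ y⁆)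
    (hri₁ : ∀ y : 𝔥₁, r₁ (i₁ y) = t₁ y)
    (hri₂ : ∀ y : 𝔥₂, r₂ (i₂ y) = t₂ y)
    (hr₂i₁ : ∀ y : 𝔥₁, r₂ (i₁ y) = 0)
    (hr₁i₂ : ∀ y : 𝔥₂, r₁ (i₂ y) = 0)
    (hi₂inj : Function.Injective i₂)
    (hr₁surj : Function.Surjective r₁)
    (hker : ∀ w : 𝔨, r₁ w = 0 ↔ ∃ y : 𝔥₂, i₂ y = w)
    (hbf₁ : ∀ (w : 𝔨) (y : 𝔥₁), i₁ (α₁ (r₁ w) y) = ⁅w, i₁ y⁆)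
    (hbf₂ : ∀ (w : 𝔨) (y : 𝔥₂), i₂ (α₂ (r₂ w) y) = ⁅w, i₂ y⁆)
    -- section of the butterfly
    (q : 𝔤₁ →ₗ[ℝ] 𝔨) (j : 𝔨 →ₗ[ℝ] 𝔥₂)
    (hq : ∀ X : 𝔤₁, r₁ (q X) = X)
    (hqj : ∀ w : 𝔨, i₂ (j w) + q (r₁ w) = w)
    -- induced maps
    (φ : 𝔤₁ → 𝔤₂) (hφ : φ = fun X => r₂ (q X))
    (f : 𝔥₁ → 𝔥₂) (hf : f = fun y => -(j (i₁ y)))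
    (lam : 𝔤₁ → 𝔤₁ → 𝔥₂) (hlam : lam = fun X Y => j ⁅q X, q Y⁆) :
    (∀ y : 𝔥₁, t₂ (f y) = φ (t₁ y)) ∧
    (∀ (X : 𝔤₁) (y : 𝔥₁), α₂ (φ X) (f y) = f (α₁ X y) + lam X (t₁ y)) ∧
    (∀ X Y : 𝔤₁, ⁅φ X, φ Y⁆ - φ ⁅X, Y⁆ = t₂ (lam X Y)) ∧
    (∀ X Y Z : 𝔤₁,
      α₂ (φ X) (lam Y Z) + α₂ (φ Y) (lam Z X) + α₂ (φ Z) (lam X Y)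
        = lam ⁅X, Y⁆ Z - lam ⁅X, Z⁆ Y + lam ⁅Y, Z⁆ X) := by
  subst hφ hf hlam
  have hij : ∀ w : 𝔨, i₂ (j w) = w - q (r₁ w) := fun w => eq_sub_of_add_eq (hqj w)
  refine ⟨?_, ?_, ?_, ?_⟩
  · intro y
    simp only [map_neg, ← hri₂, hij, map_sub, hr₂i₁, hri₁]
    abel
  · intro X y
    apply hi₂inj
    have h := hbf₁ (q X) y
    rw [hq] at h
    simp only [hbf₂, map_add, map_neg, hij, hri₁, hequiv₁, hr₁, hq, h, lie_neg, lie_sub]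
    abel
  · intro X Y
    simp only [← hri₂, hij, map_sub, hr₂, hr₁, hq]
  · intro X Y Z
    apply hi₂inj
    have hJ : ⁅q X, ⁅q Y, q Z⁆⁆ + ⁅q Y, ⁅q Z, q X⁆⁆ + ⁅q Z, ⁅q X, q Y⁆⁆ = 0 :=
      lie_jacobi _ _ _
    have hJ' : q ⁅X, ⁅Y, Z⁆⁆ + q ⁅Y, ⁅Z, X⁆⁆ + q ⁅Z, ⁅X, Y⁆⁆ = 0 := by
      rw [← map_add, ← map_add, lie_jacobi, map_zero]
    have e1 : ∀ A B C : 𝔤₁, ⁅q ⁅A, B⁆, q C⁆ = -⁅q C, q ⁅A, B⁆⁆ := fun A B C =>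
      (lie_skew _ _).symm
    have e2 : ∀ A B C : 𝔤₁, ⁅⁅A, B⁆, C⁆ = -⁅C, ⁅A, B⁆⁆ := fun A B C =>
      (lie_skew _ _).symm
    have e3 : ⁅X, Z⁆ = -⁅Z, X⁆ := (lie_skew _ _).symm
    simp only [hbf₂, map_add, map_sub, hij, hr₁, hq, lie_sub, e1, e2, e3, map_neg, lie_neg,
      neg_lie]
    rw [← sub_eq_zero]
    calc _ = (⁅q X, ⁅q Y, q Z⁆⁆ + ⁅q Y, ⁅q Z, q X⁆⁆ + ⁅q Z, ⁅q X, q Y⁆⁆)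
          - (q ⁅X, ⁅Y, Z⁆⁆ + q ⁅Y, ⁅Z, X⁆⁆ + q ⁅Z, ⁅X, Y⁆⁆) := by abel
      _ = 0 := by rw [hJ, hJ', sub_zero]
end

section
/- Let 𝔤 be a real Lie algebra and V a real vector space. Let η : 𝔤 × 𝔤 → V be a bilinear map, with symmetric part η^s(X,Y) := (η(X,Y) + η(Y,X))/2 and antisymmetric part η^a(X,Y) := (η(X,Y) − η(Y,X))/2. Then η satisfies η([X,Y],Z) + η(Y,[X,Z]) = η(X,[Y,Z]) for all X,Y,Z ∈ 𝔤 if and only if both of the following hold: (i) η^s is ad-invariant, i.e. η^s([X,Y],Z) + η^s(Y,[X,Z]) = 0 for all X,Y,Z ∈ 𝔤; and (ii) δη^a + cw(η^s) = 0, i.e. −η^a([X,Y],Z) + η^a([X,Z],Y) − η^a([Y,Z],X) + η^s([X,Y],Z) = 0 for all X,Y,Z ∈ 𝔤. -/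
/-- Lemma 4.1: a bilinear map `η : 𝔤 × 𝔤 → V` satisfies the
`T`-condition `η([X,Y],Z) + η(Y,[X,Z]) = η(X,[Y,Z])` iff its symmetric part `η^s` is
ad-invariant and `δη^a + cw(η^s) = 0`. -/
theorem statement11
    {𝔤 V : Type*} [LieRing 𝔤] [LieAlgebra ℝ 𝔤] [AddCommGroup V] [Module ℝ V]
    (η : 𝔤 →ₗ[ℝ] 𝔤 →ₗ[ℝ] V)
    (ηs ηa : 𝔤 → 𝔤 → V)
    (hηs : ηs = fun X Y => (2⁻¹ : ℝ) • (η X Y + η Y X))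
    (hηa : ηa = fun X Y => (2⁻¹ : ℝ) • (η X Y - η Y X)) :
    (∀ X Y Z : 𝔤, η ⁅X, Y⁆ Z + η Y ⁅X, Z⁆ = η X ⁅Y, Z⁆) ↔
      ((∀ X Y Z : 𝔤, ηs ⁅X, Y⁆ Z + ηs Y ⁅X, Z⁆ = 0) ∧
       (∀ X Y Z : 𝔤,
         -ηa ⁅X, Y⁆ Z + ηa ⁅X, Z⁆ Y - ηa ⁅Y, Z⁆ X + ηs ⁅X, Y⁆ Z = 0)) := by
  subst hηs hηa
  have eL : ∀ A B C : 𝔤, η ⁅A, B⁆ C = - η ⁅B, A⁆ C := fun A B C => by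
    rw [← lie_skew A B, map_neg, LinearMap.neg_apply]
  have eR : ∀ A B C : 𝔤, η C ⁅A, B⁆ = - η C ⁅B, A⁆ := fun A B C => by
    rw [← lie_skew A B, map_neg]
  constructor
  · intro h
    refine ⟨fun X Y Z => ?_, fun X Y Z => ?_⟩
    · have h1 := h X Y Z
      have h2 := h X Z Y
      rw [eR Z Y X] at h2
      linear_combination (norm := module) (2⁻¹ : ℝ) • h1 + (2⁻¹ : ℝ) • h2
    · have h2 := h X Z Y
      have h3 := h Z Y X
      rw [eR Z Y X] at h2
      rw [eL Z Y X, eR Z X Y, eR Y X Z] at h3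
      linear_combination (norm := module) (2⁻¹ : ℝ) • h2 + (2⁻¹ : ℝ) • h3
  · rintro ⟨hi, hii⟩ X Y Z
    have h1 := hi X Y Z
    have h2 := hi Y X Z
    have h3 := hii X Y Z
    simp only [eL Y X Z, eR Y X Z] at h1 h2 h3
    linear_combination (norm := module) h1 - h2 - h3
end

section
/- Let 𝔤 be a real Lie algebra, V a real vector space, and B : 𝔤 × 𝔤 → V a symmetric bilinear map which is ad-invariant, i.e. B([X,Y],Z) = B(X,[Y,Z]) for all X,Y,Z ∈ 𝔤. Then the following are equivalent: (i) there exists a bilinear map η : 𝔤 × 𝔤 → V with η([X,Y],Z) + η(Y,[X,Z]) = η(X,[Y,Z]) for all X,Y,Z and with symmetric part B, i.e. η(X,Y) + η(Y,X) = 2·B(X,Y); (ii) the Chern–Weil 3-cocycle cw(B)(X,Y,Z) := B([X,Y],Z) is a Chevalley–Eilenberg coboundary, i.e. there exists an alternating bilinear map λ : 𝔤 × 𝔤 → V with −λ([X,Y],Z) + λ([X,Z],Y) − λ([Y,Z],X) = −B([X,Y],Z) for all X,Y,Z ∈ 𝔤. -/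
/-- exactness of the four-term sequence (19) at `Sym²(𝔤,V)^{ad}`: for
a symmetric ad-invariant bilinear map `B`, there exists `η ∈ T(𝔤,V)` with symmetric part
`B` iff the Chern–Weil 3-cocycle `cw(B)` is a Chevalley–Eilenberg coboundary. -/
theorem statement12
    {𝔤 V : Type*} [LieRing 𝔤] [LieAlgebra ℝ 𝔤] [AddCommGroup V] [Module ℝ V]
    (B : 𝔤 →ₗ[ℝ] 𝔤 →ₗ[ℝ] V)
    (hsymm : ∀ X Y : 𝔤, B X Y = B Y X)
    (hinv : ∀ X Y Z : 𝔤, B ⁅X, Y⁆ Z = B X ⁅Y, Z⁆) :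
    (∃ η : 𝔤 →ₗ[ℝ] 𝔤 →ₗ[ℝ] V,
        (∀ X Y Z : 𝔤, η ⁅X, Y⁆ Z + η Y ⁅X, Z⁆ = η X ⁅Y, Z⁆) ∧
        (∀ X Y : 𝔤, η X Y + η Y X = (2 : ℝ) • B X Y)) ↔
      (∃ lam : 𝔤 →ₗ[ℝ] 𝔤 →ₗ[ℝ] V,
        (∀ X Y : 𝔤, lam X Y = - lam Y X) ∧
        (∀ X Y Z : 𝔤,
          -lam ⁅X, Y⁆ Z + lam ⁅X, Z⁆ Y - lam ⁅Y, Z⁆ X = - B ⁅X, Y⁆ Z)) := by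
  have hB : ∀ X Y Z : 𝔤, B Y ⁅X, Z⁆ = - B ⁅X, Y⁆ Z := by
    intro X Y Z
    rw [← hinv, ← lie_skew X Y, map_neg, LinearMap.neg_apply, neg_neg]
  constructor
  · rintro ⟨η, h1, h2⟩
    have hs : ∀ X Y : 𝔤, η X Y = B X Y + B X Y - η Y X := by
      intro X Y
      rw [← two_smul ℝ (B X Y), ← h2 X Y]
      abel
    refine ⟨η - B, ?_, ?_⟩
    · intro X Y
      simp only [LinearMap.sub_apply]
      rw [hs X Y, hsymm Y X]
      abel
    · intro X Y Z
      simp only [LinearMap.sub_apply]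
      have h := h1 X Y Z
      rw [hs Y ⁅X, Z⁆, hs X ⁅Y, Z⁆, hB X Y Z, ← hinv X Y Z] at h
      rw [hsymm ⁅X, Z⁆ Y, hB X Y Z, hsymm ⁅Y, Z⁆ X, ← hinv X Y Z]
      have h' := sub_eq_zero.mpr h
      rw [← sub_eq_zero, ← neg_eq_zero, ← h']
      abel
  · rintro ⟨lam, h1, h2⟩
    refine ⟨B + lam, ?_, ?_⟩
    · intro X Y Z
      simp only [LinearMap.add_apply]
      have h' := sub_eq_zero.mpr (h2 X Y Z)
      rw [hB X Y Z, ← hinv X Y Z, h1 Y ⁅X, Z⁆, h1 X ⁅Y, Z⁆]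
      rw [← sub_eq_zero, ← neg_eq_zero, ← h']
      abel
    · intro X Y
      simp only [LinearMap.add_apply]
      rw [h1 X Y, hsymm Y X, two_smul]
      abel
end

section
/- Let (𝔥,𝔤,t,α) be a central crossed module of Lie algebras and u a half splitting, with associated 2-cochain ω_u. Then for all X,Y ∈ 𝔤 and x,y ∈ 𝔥: ω_u(X,t(y)) = α(X,y) and ω_u(t(x),Y) = −α(Y,x). -/
/-- Lemma 3.1: for a central crossed module of Lie algebras and a half
splitting `u`, the cochain `ω_u` satisfies `ω_u(X, t(y)) = α(X,y)` and
`ω_u(t(x), Y) = −α(Y,x)`. -/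
theorem statement13
    {𝔥 𝔤 : Type*} [LieRing 𝔥] [LieAlgebra ℝ 𝔥] [LieRing 𝔤] [LieAlgebra ℝ 𝔤]
    (t : 𝔥 →ₗ[ℝ] 𝔤) (ht : ∀ x y : 𝔥, t ⁅x, y⁆ = ⁅t x, t y⁆)
    (α : 𝔤 →ₗ[ℝ] 𝔥 →ₗ[ℝ] 𝔥)
    (hder : ∀ (X : 𝔤) (y z : 𝔥), α X ⁅y, z⁆ = ⁅α X y, z⁆ + ⁅y, α X z⁆)
    (hact : ∀ (X Y : 𝔤) (z : 𝔥), α ⁅X, Y⁆ z = α X (α Y z) - α Y (α X z))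
    (hequiv : ∀ (X : 𝔤) (y : 𝔥), t (α X y) = ⁅X, t y⁆)
    (hpeiffer : ∀ x y : 𝔥, α (t x) y = ⁅x, y⁆)
    (hcentral : ∀ (X : 𝔤) (a : 𝔥), t a = 0 → α X a = 0)
    (u : 𝔤 →ₗ[ℝ] 𝔥) (hu : ∀ x : 𝔥, t (u (t x)) = t x) :
    (∀ (X : 𝔤) (y : 𝔥), omegaU t α u X (t y) = α X y) ∧
    (∀ (x : 𝔥) (Y : 𝔤), omegaU t α u (t x) Y = - α Y x) := by
  have h1 : ∀ (X : 𝔤) (y : 𝔥), α X (u (t y)) = α X y := by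
    intro X y
    have h := hcentral X (u (t y) - y) (by rw [map_sub, hu, sub_self])
    rwa [map_sub, sub_eq_zero] at h
  have h2 : ∀ y z : 𝔥, ⁅u (t y), z⁆ = ⁅y, z⁆ := by
    intro y z
    rw [← hpeiffer, hu, hpeiffer]
  constructor
  · intro X y
    have h3 : ⁅u X, u (t y)⁆ = - ⁅y, u X⁆ := by
      rw [← lie_skew, h2]
    unfold omegaU
    rw [h1, hpeiffer, h3, hu, sub_self, lie_zero, map_zero]
    abel
  · intro x Y
    unfold omegaU
    rw [h1, hpeiffer, h2, hu, sub_self, zero_lie, map_zero]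
    abel
end

section
/- Let (𝔥,𝔤,t,α) be a central crossed module of Lie algebras and u a half splitting, with ρ := t∘u and associated 2-cochain ω_u. Then for all X,Y ∈ 𝔤: t(ω_u(X,Y)) = t(u([X,Y])) = ρ([X,Y]). -/
/-- Lemma 3.3: for a central crossed module of Lie algebras and a half
splitting `u` with `ρ = t ∘ u`, one has `t(ω_u(X,Y)) = t(u([X,Y])) = ρ([X,Y])`. -/
theorem statement14
    {𝔥 𝔤 : Type*} [LieRing 𝔥] [LieAlgebra ℝ 𝔥] [LieRing 𝔤] [LieAlgebra ℝ 𝔤]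
    (t : 𝔥 →ₗ[ℝ] 𝔤) (ht : ∀ x y : 𝔥, t ⁅x, y⁆ = ⁅t x, t y⁆)
    (α : 𝔤 →ₗ[ℝ] 𝔥 →ₗ[ℝ] 𝔥)
    (hder : ∀ (X : 𝔤) (y z : 𝔥), α X ⁅y, z⁆ = ⁅α X y, z⁆ + ⁅y, α X z⁆)
    (hact : ∀ (X Y : 𝔤) (z : 𝔥), α ⁅X, Y⁆ z = α X (α Y z) - α Y (α X z))
    (hequiv : ∀ (X : 𝔤) (y : 𝔥), t (α X y) = ⁅X, t y⁆)
    (hpeiffer : ∀ x y : 𝔥, α (t x) y = ⁅x, y⁆)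
    (hcentral : ∀ (X : 𝔤) (a : 𝔥), t a = 0 → α X a = 0)
    (u : 𝔤 →ₗ[ℝ] 𝔥) (hu : ∀ x : 𝔥, t (u (t x)) = t x) :
    ∀ X Y : 𝔤, t (omegaU t α u X Y) = t (u ⁅X, Y⁆) := by
  intro X Y
  have key : ⁅X - t (u X), Y - t (u Y)⁆ =
      ⁅X, Y⁆ - t (α X (u Y) - α Y (u X) - ⁅u X, u Y⁆) := by
    simp only [map_sub, hequiv, ht, sub_lie, lie_sub]
    rw [← lie_skew Y (t (u X))]
    abel
  unfold omegaU
  rw [key, map_add, map_sub u, map_sub t (u _), hu]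
  abel
end

section
/- Let (𝔥,𝔤,t,α) be a central crossed module of Lie algebras and u a half splitting, with associated 2-cochain ω_u and its Chevalley–Eilenberg differential δω_u (trivial coefficients). Then: (i) δω_u(t(x),Y,Z) = 0 for all x ∈ 𝔥 and Y,Z ∈ 𝔤 (hence, by alternation, δω_u vanishes as soon as one of its three arguments lies in the range of t); and (ii) t(δω_u(X,Y,Z)) = 0 for all X,Y,Z ∈ 𝔤 (δω_u takes values in ker t). -/
/-- Lemma 3.4: for a central crossed module of Lie algebras and a half
splitting `u`, the 3-cocycle `δω_u` vanishes as soon as one argument lies in the range of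
`t`, and it takes values in `ker t`. -/
theorem statement15
    {𝔥 𝔤 : Type*} [LieRing 𝔥] [LieAlgebra ℝ 𝔥] [LieRing 𝔤] [LieAlgebra ℝ 𝔤]
    (t : 𝔥 →ₗ[ℝ] 𝔤) (ht : ∀ x y : 𝔥, t ⁅x, y⁆ = ⁅t x, t y⁆)
    (α : 𝔤 →ₗ[ℝ] 𝔥 →ₗ[ℝ] 𝔥)
    (hder : ∀ (X : 𝔤) (y z : 𝔥), α X ⁅y, z⁆ = ⁅α X y, z⁆ + ⁅y, α X z⁆)
    (hact : ∀ (X Y : 𝔤) (z : 𝔥), α ⁅X, Y⁆ z = α X (α Y z) - α Y (α X z))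
    (hequiv : ∀ (X : 𝔤) (y : 𝔥), t (α X y) = ⁅X, t y⁆)
    (hpeiffer : ∀ x y : 𝔥, α (t x) y = ⁅x, y⁆)
    (hcentral : ∀ (X : 𝔤) (a : 𝔥), t a = 0 → α X a = 0)
    (u : 𝔤 →ₗ[ℝ] 𝔥) (hu : ∀ x : 𝔥, t (u (t x)) = t x) :
    (∀ (x : 𝔥) (Y Z : 𝔤), ceDiff (omegaU t α u) (t x) Y Z = 0) ∧
    (∀ X Y Z : 𝔤, t (ceDiff (omegaU t α u) X Y Z) = 0) := by
  have hc : ∀ (X : 𝔤) (x : 𝔥), α X (u (t x)) = α X x := by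
    intro X x
    have := hcentral X (u (t x) - x) (by rw [map_sub, hu, sub_self])
    rwa [map_sub, sub_eq_zero] at this
  have hω1 : ∀ (x : 𝔥) (Y : 𝔤), omegaU t α u (t x) Y = -α Y x := by
    intro x Y
    have h1 : ⁅u (t x), u Y⁆ = ⁅x, u Y⁆ := by
      rw [← hpeiffer, hu, hpeiffer]
    unfold omegaU
    rw [h1, hpeiffer, hc, hu, sub_self, zero_lie, map_zero]
    abel
  have hanti : ∀ X Y : 𝔤, omegaU t α u X Y = -omegaU t α u Y X := by
    intro X Y
    unfold omegaU
    rw [← lie_skew (u X) (u Y), ← lie_skew (X - t (u X)) (Y - t (u Y)), map_neg]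
    abel
  have hρ : ∀ X Y : 𝔤, t (omegaU t α u X Y) = t (u ⁅X, Y⁆) := by
    intro X Y
    have e : ⁅X - t (u X), Y - t (u Y)⁆ =
        ⁅X, Y⁆ - t (α X (u Y) - α Y (u X) - ⁅u X, u Y⁆) := by
      simp only [map_sub, hequiv, ht, sub_lie, lie_sub]
      rw [← lie_skew (t (u X)) Y]
      abel
    unfold omegaU
    rw [e]
    generalize α X (u Y) - α Y (u X) - ⁅u X, u Y⁆ = w
    rw [map_add, map_sub, map_sub, hu]
    abel
  constructor
  · intro x Y Z
    have hl : ∀ W : 𝔤, ⁅t x, W⁆ = t (-α W x) := by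
      intro W
      rw [map_neg, hequiv, lie_skew]
    unfold ceDiff
    rw [hl, hl, hω1, hω1, hanti ⁅Y, Z⁆ (t x), hω1, hact]
    simp only [map_neg]
    abel
  · intro X Y Z
    have j : -⁅⁅X, Y⁆, Z⁆ + ⁅⁅X, Z⁆, Y⁆ - ⁅⁅Y, Z⁆, X⁆ = 0 := by
      rw [← lie_skew ⁅X, Z⁆ Y, ← lie_skew ⁅Y, Z⁆ X, leibniz_lie X Y Z]
      abel
    unfold ceDiff
    rw [map_sub, map_add, map_neg, hρ, hρ, hρ, ← map_neg, ← map_neg, ← map_add, ← map_add,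
      ← map_sub, ← map_sub, j, map_zero, map_zero]
end

section
/- Let (𝔥,𝔤,t,α) be a central crossed module of Lie algebras and u a half splitting, with associated 2-cochain ω_u. Let 𝔤′ be a real Lie algebra, φ : 𝔤′ → 𝔤 a linear map, and λ : 𝔤′ × 𝔤′ → 𝔥 an alternating bilinear map such that [φ(X),φ(Y)] − φ([X,Y]) = t(λ(X,Y)) for all X,Y ∈ 𝔤′. Then for all X,Y,Z ∈ 𝔤′: δω_u(φ(X),φ(Y),φ(Z)) = δ(φ*ω_u)(X,Y,Z) + α(φ(X),λ(Y,Z)) + α(φ(Y),λ(Z,X)) + α(φ(Z),λ(X,Y)), where φ*ω_u(X,Y) := ω_u(φ(X),φ(Y)), δω_u is formed with the bracket of 𝔤, and δ(φ*ω_u) is formed with the bracket of 𝔤′. -/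
/-- Lemma 3.2: if `φ : 𝔤′ → 𝔤` is linear and `λ` is an alternating
bilinear map with `[φ(X),φ(Y)] − φ([X,Y]) = t(λ(X,Y))`, then
`δω_u(φX,φY,φZ) = δ(φ*ω_u)(X,Y,Z) + α(φX,λ(Y,Z)) + α(φY,λ(Z,X)) + α(φZ,λ(X,Y))`. -/
theorem statement16
    {𝔥 𝔤 : Type*} [LieRing 𝔥] [LieAlgebra ℝ 𝔥] [LieRing 𝔤] [LieAlgebra ℝ 𝔤]
    (t : 𝔥 →ₗ[ℝ] 𝔤) (ht : ∀ x y : 𝔥, t ⁅x, y⁆ = ⁅t x, t y⁆)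
    (α : 𝔤 →ₗ[ℝ] 𝔥 →ₗ[ℝ] 𝔥)
    (hder : ∀ (X : 𝔤) (y z : 𝔥), α X ⁅y, z⁆ = ⁅α X y, z⁆ + ⁅y, α X z⁆)
    (hact : ∀ (X Y : 𝔤) (z : 𝔥), α ⁅X, Y⁆ z = α X (α Y z) - α Y (α X z))
    (hequiv : ∀ (X : 𝔤) (y : 𝔥), t (α X y) = ⁅X, t y⁆)
    (hpeiffer : ∀ x y : 𝔥, α (t x) y = ⁅x, y⁆)
    (hcentral : ∀ (X : 𝔤) (a : 𝔥), t a = 0 → α X a = 0)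
    (u : 𝔤 →ₗ[ℝ] 𝔥) (hu : ∀ x : 𝔥, t (u (t x)) = t x)
    {𝔤' : Type*} [LieRing 𝔤'] [LieAlgebra ℝ 𝔤']
    (φ : 𝔤' →ₗ[ℝ] 𝔤) (lam : 𝔤' →ₗ[ℝ] 𝔤' →ₗ[ℝ] 𝔥)
    (hlam_alt : ∀ X Y : 𝔤', lam X Y = - lam Y X)
    (hlam : ∀ X Y : 𝔤', ⁅φ X, φ Y⁆ - φ ⁅X, Y⁆ = t (lam X Y)) :
    ∀ X Y Z : 𝔤',
      ceDiff (omegaU t α u) (φ X) (φ Y) (φ Z)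
        = ceDiff (fun X Y => omegaU t α u (φ X) (φ Y)) X Y Z
          + α (φ X) (lam Y Z) + α (φ Y) (lam Z X) + α (φ Z) (lam X Y) := by
  intro X Y Z
  have hadd : ∀ A B W : 𝔤, omegaU t α u (A + B) W = omegaU t α u A W + omegaU t α u B W := by
    intro A B W
    have e : A + B - t (u (A + B)) = (A - t (u A)) + (B - t (u B)) := by
      rw [map_add, map_add]; abel
    unfold omegaU
    rw [e]
    simp only [map_add, LinearMap.add_apply, add_lie]
    abel
  have hker : ∀ (x : 𝔥) (W : 𝔤), omegaU t α u (t x) W = - α W x := by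
    intro x W
    have h1 : α W (u (t x)) = α W x := by
      have h := hcentral W (u (t x) - x) (by rw [map_sub, hu, sub_self])
      rw [map_sub] at h
      exact sub_eq_zero.mp h
    have h2 : ⁅u (t x), u W⁆ = ⁅x, u W⁆ := by
      rw [← hpeiffer, hu, hpeiffer]
    unfold omegaU
    rw [h1, h2, hpeiffer, hu, sub_self, zero_lie, map_zero]
    abel
  have key : ∀ A B C : 𝔤', omegaU t α u ⁅φ A, φ B⁆ (φ C)
      = omegaU t α u (φ ⁅A, B⁆) (φ C) - α (φ C) (lam A B) := by
    intro A B C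
    have e : ⁅φ A, φ B⁆ = φ ⁅A, B⁆ + t (lam A B) := by
      rw [← hlam]; abel
    rw [e, hadd, hker, sub_eq_add_neg]
  unfold ceDiff
  rw [key, key, key, hlam_alt Z X, map_neg]
  abel
end

section
/- Let (𝔥,𝔤,t,α) be a central crossed module of Lie algebras and let u and u′ be two half splittings, with associated 2-cochains ω_u and ω_{u′}. Set v := u′ − u and define τ : 𝔤 × 𝔤 → 𝔥 by τ(X,Y) := ω_{u′}(X,Y) − ω_u(X,Y) − u(t(v([X,Y]))). Then: (i) ω_{u′}(t(x),Y) = ω_u(t(x),Y) and ω_{u′}(X,t(y)) = ω_u(X,t(y)) for all x,y ∈ 𝔥, X,Y ∈ 𝔤 (the difference ω_{u′} − ω_u vanishes on the range of t); (ii) τ(t(x),Y) = 0 and τ(X,t(y)) = 0 for all x,y ∈ 𝔥, X,Y ∈ 𝔤; and (iii) t(τ(X,Y)) = 0 for all X,Y ∈ 𝔤. Consequently the Kassel–Loday cocycles of u and u′ differ by the coboundary of a ker t-valued 2-cochain descending to 𝔤/t(𝔥). -/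
/-- Lemma 3.5: for two half splittings `u`, `u′` of a central crossed
module of Lie algebras, with `v = u′ − u` and
`τ(X,Y) = ω_{u′}(X,Y) − ω_u(X,Y) − u(t(v([X,Y])))`:
(i) the difference `ω_{u′} − ω_u` vanishes on the range of `t`;
(ii) `τ` vanishes on the range of `t`; and
(iii) `τ` takes values in `ker t`. -/
theorem statement17
    {𝔥 𝔤 : Type*} [LieRing 𝔥] [LieAlgebra ℝ 𝔥] [LieRing 𝔤] [LieAlgebra ℝ 𝔤]
    (t : 𝔥 →ₗ[ℝ] 𝔤) (ht : ∀ x y : 𝔥, t ⁅x, y⁆ = ⁅t x, t y⁆)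
    (α : 𝔤 →ₗ[ℝ] 𝔥 →ₗ[ℝ] 𝔥)
    (hder : ∀ (X : 𝔤) (y z : 𝔥), α X ⁅y, z⁆ = ⁅α X y, z⁆ + ⁅y, α X z⁆)
    (hact : ∀ (X Y : 𝔤) (z : 𝔥), α ⁅X, Y⁆ z = α X (α Y z) - α Y (α X z))
    (hequiv : ∀ (X : 𝔤) (y : 𝔥), t (α X y) = ⁅X, t y⁆)
    (hpeiffer : ∀ x y : 𝔥, α (t x) y = ⁅x, y⁆)
    (hcentral : ∀ (X : 𝔤) (a : 𝔥), t a = 0 → α X a = 0)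
    (u : 𝔤 →ₗ[ℝ] 𝔥) (hu : ∀ x : 𝔥, t (u (t x)) = t x)
    (u' : 𝔤 →ₗ[ℝ] 𝔥) (hu' : ∀ x : 𝔥, t (u' (t x)) = t x)
    (v : 𝔤 → 𝔥) (hv : v = fun X => u' X - u X)
    (τ : 𝔤 → 𝔤 → 𝔥)
    (hτ : τ = fun X Y => omegaU t α u' X Y - omegaU t α u X Y - u (t (v ⁅X, Y⁆))) :
    (∀ (x : 𝔥) (Y : 𝔤), omegaU t α u' (t x) Y = omegaU t α u (t x) Y) ∧
    (∀ (X : 𝔤) (y : 𝔥), omegaU t α u' X (t y) = omegaU t α u X (t y)) ∧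
    (∀ (x : 𝔥) (Y : 𝔤), τ (t x) Y = 0) ∧
    (∀ (X : 𝔤) (y : 𝔥), τ X (t y) = 0) ∧
    (∀ X Y : 𝔤, t (τ X Y) = 0) := by
  have A : ∀ w : 𝔤 →ₗ[ℝ] 𝔥, (∀ x, t (w (t x)) = t x) →
      ∀ x Y, omegaU t α w (t x) Y = - α Y x := by
    intro w hw x Y
    have h0 : t (x - w (t x)) = 0 := by rw [map_sub, hw, sub_self]
    have h1 : ⁅x, w Y⁆ - ⁅w (t x), w Y⁆ = 0 := by
      rw [← sub_lie, ← hpeiffer, h0]; simp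
    have h2 : α Y x - α Y (w (t x)) = 0 := by
      rw [← map_sub]; exact hcentral Y _ h0
    simp only [omegaU, hw, sub_self, zero_lie, map_zero, add_zero, hpeiffer]
    rw [sub_eq_zero] at h1 h2
    rw [h1, h2]; abel
  have B : ∀ w : 𝔤 →ₗ[ℝ] 𝔥, (∀ x, t (w (t x)) = t x) →
      ∀ X y, omegaU t α w X (t y) = α X y := by
    intro w hw X y
    have h : omegaU t α w X (t y) = - omegaU t α w (t y) X := by
      simp only [omegaU]
      rw [← lie_skew (w X), ← lie_skew (X - t (w X)), map_neg]
      abel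
    rw [h, A w hw, neg_neg]
  have C : ∀ w : 𝔤 →ₗ[ℝ] 𝔥, (∀ x, t (w (t x)) = t x) →
      ∀ X Y, t (omegaU t α w X Y) = t (w ⁅X, Y⁆) := by
    intro w hw X Y
    have h : ⁅X - t (w X), Y - t (w Y)⁆
        = ⁅X, Y⁆ - t (α X (w Y) - α Y (w X) - ⁅w X, w Y⁆) := by
      simp only [map_sub, hequiv, ht, sub_lie, lie_sub]
      rw [← lie_skew Y (t (w X))]
      abel
    simp only [omegaU]
    rw [h, map_sub w, map_add, map_sub t (w _), hw]
    abel
  have D : ∀ x, t (v (t x)) = 0 := by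
    intro x
    rw [hv]; simp only [map_sub, hu, hu', sub_self]
  have E : ∀ (X : 𝔤) (y : 𝔥), t (v ⁅X, t y⁆) = 0 := by
    intro X y
    rw [← hequiv]; exact D _
  have F : ∀ (x : 𝔥) (Y : 𝔤), t (v ⁅t x, Y⁆) = 0 := by
    intro x Y
    rw [← lie_skew, ← hequiv, ← map_neg]; exact D _
  refine ⟨?_, ?_, ?_, ?_, ?_⟩
  · intro x Y
    rw [A u hu, A u' hu']
  · intro X y
    rw [B u hu, B u' hu']
  · intro x Y
    rw [hτ]
    simp only [A u hu, A u' hu', F, map_zero, sub_self]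
  · intro X y
    rw [hτ]
    simp only [B u hu, B u' hu', E, map_zero, sub_self]
  · intro X Y
    rw [hτ]
    simp only [map_sub, C u hu, C u' hu', hu]
    rw [hv]
    simp only [map_sub, hu, sub_self]
end

section
/- Let (𝔥,𝔤,t,α) be a central crossed module of Lie algebras and η an infinitesimal adjustment. Then: (i) the symmetric part of η vanishes on the range of t, i.e. η(t(x),Y) + η(Y,t(x)) = 0 for all x ∈ 𝔥 and Y ∈ 𝔤; (ii) the symmetric part is ad-invariant, i.e. with η^s(X,Y) := (η(X,Y) + η(Y,X))/2 one has η^s([X,Y],Z) + η^s(Y,[X,Z]) = 0 for all X,Y,Z ∈ 𝔤; and (iii) if η is adapted to an idempotent linear map ρ : 𝔤 → 𝔤 with range t(𝔥), then t(η(X,Y) + η(Y,X)) = 0 for all X,Y ∈ 𝔤 (the symmetric part takes values in ker t). -/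
/-- Lemma 4.4: for an infinitesimal adjustment `η` on a central
crossed module of Lie algebras: (i) the symmetric part of `η` vanishes on the range of
`t`; (ii) the symmetric part is ad-invariant; (iii) if `η` is adapted to an idempotent
`ρ` with range `t(𝔥)`, then the symmetric part takes values in `ker t`. -/
theorem statement18
    {𝔥 𝔤 : Type*} [LieRing 𝔥] [LieAlgebra ℝ 𝔥] [LieRing 𝔤] [LieAlgebra ℝ 𝔤]
    (t : 𝔥 →ₗ[ℝ] 𝔤) (ht : ∀ x y : 𝔥, t ⁅x, y⁆ = ⁅t x, t y⁆)
    (α : 𝔤 →ₗ[ℝ] 𝔥 →ₗ[ℝ] 𝔥)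
    (hder : ∀ (X : 𝔤) (y z : 𝔥), α X ⁅y, z⁆ = ⁅α X y, z⁆ + ⁅y, α X z⁆)
    (hact : ∀ (X Y : 𝔤) (z : 𝔥), α ⁅X, Y⁆ z = α X (α Y z) - α Y (α X z))
    (hequiv : ∀ (X : 𝔤) (y : 𝔥), t (α X y) = ⁅X, t y⁆)
    (hpeiffer : ∀ x y : 𝔥, α (t x) y = ⁅x, y⁆)
    (hcentral : ∀ (X : 𝔤) (a : 𝔥), t a = 0 → α X a = 0)
    (η : 𝔤 →ₗ[ℝ] 𝔤 →ₗ[ℝ] 𝔥)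
    (hη₁ : ∀ X Y Z : 𝔤, η ⁅X, Y⁆ Z + η Y ⁅X, Z⁆ = η X ⁅Y, Z⁆)
    (hη₂ : ∀ (x : 𝔥) (Y : 𝔤), η (t x) Y = - α Y x)
    (hη₃ : ∀ (X : 𝔤) (y : 𝔥), η X (t y) = α X y)
    (ηs : 𝔤 → 𝔤 → 𝔥)
    (hηs : ηs = fun X Y => (2⁻¹ : ℝ) • (η X Y + η Y X)) :
    (∀ (x : 𝔥) (Y : 𝔤), η (t x) Y + η Y (t x) = 0) ∧
    (∀ X Y Z : 𝔤, ηs ⁅X, Y⁆ Z + ηs Y ⁅X, Z⁆ = 0) ∧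
    (∀ ρ : 𝔤 →ₗ[ℝ] 𝔤, ρ ∘ₗ ρ = ρ →
      LinearMap.range ρ = LinearMap.range t →
      (∀ X Y : 𝔤, t (η X Y) = ρ ⁅X, Y⁆) →
      (∀ X Y : 𝔤, t (η X Y + η Y X) = 0)) := by
  refine ⟨fun x Y => ?_, fun X Y Z => ?_, fun ρ _ _ h X Y => ?_⟩
  · rw [hη₂, hη₃, neg_add_cancel]
  · subst hηs
    have h1 := hη₁ X Y Z
    have h2 := hη₁ X Z Y
    have h3 : η X ⁅Y, Z⁆ + η X ⁅Z, Y⁆ = 0 := by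
      rw [← lie_skew Y Z, map_neg, neg_add_cancel]
    have h4 : (η ⁅X, Y⁆ Z + η Z ⁅X, Y⁆) + (η Y ⁅X, Z⁆ + η ⁅X, Z⁆ Y) = 0 := by
      rw [← h3, ← h1, ← h2]
      abel
    change (2⁻¹ : ℝ) • (η ⁅X, Y⁆ Z + η Z ⁅X, Y⁆) + (2⁻¹ : ℝ) • (η Y ⁅X, Z⁆ + η ⁅X, Z⁆ Y) = 0
    rw [← smul_add, h4, smul_zero]
  · rw [map_add, h, h, ← lie_skew X Y, map_neg, neg_add_cancel]
end

section
/- Let (𝔥,𝔤,t,α) be a crossed module of Lie algebras such that t : 𝔥 → 𝔤 is surjective. Then: (i) every a ∈ 𝔥 with t(a) = 0 is central in 𝔥, and the crossed module is central (α(X,a) = 0 for all X ∈ 𝔤 and a ∈ ker t); (ii) there is a well-defined bilinear map η : 𝔤 × 𝔤 → 𝔥 determined by η(t(x),t(y)) = [x,y], i.e. [x,y] = [x′,y′] whenever t(x) = t(x′) and t(y) = t(y′); (iii) η is an infinitesimal adjustment on this crossed module, adapted to the identity idempotent ρ = id_𝔤 (which has range t(𝔥) = 𝔤); and (iv) η is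 the unique infinitesimal adjustment on this crossed module. -/
/-- Section 7.4: for a crossed module of Lie algebras with `t`
surjective: (i) every element of `ker t` is central in `𝔥` and the crossed module is
central; (ii) the formula `η(t(x),t(y)) = [x,y]` is well defined; (iii) it defines an
infinitesimal adjustment adapted to the identity idempotent; (iv) this is the unique
infinitesimal adjustment. -/
theorem statement19
    {𝔥 𝔤 : Type*} [LieRing 𝔥] [LieAlgebra ℝ 𝔥] [LieRing 𝔤] [LieAlgebra ℝ 𝔤]
    (t : 𝔥 →ₗ[ℝ] 𝔤) (ht : ∀ x y : 𝔥, t ⁅x, y⁆ = ⁅t x, t y⁆)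
    (α : 𝔤 →ₗ[ℝ] 𝔥 →ₗ[ℝ] 𝔥)
    (hder : ∀ (X : 𝔤) (y z : 𝔥), α X ⁅y, z⁆ = ⁅α X y, z⁆ + ⁅y, α X z⁆)
    (hact : ∀ (X Y : 𝔤) (z : 𝔥), α ⁅X, Y⁆ z = α X (α Y z) - α Y (α X z))
    (hequiv : ∀ (X : 𝔤) (y : 𝔥), t (α X y) = ⁅X, t y⁆)
    (hpeiffer : ∀ x y : 𝔥, α (t x) y = ⁅x, y⁆)
    (hsurj : Function.Surjective t) :
    -- (i) elements of `ker t` are central in `𝔥`, and the crossed module is central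
    (∀ a : 𝔥, t a = 0 → ∀ y : 𝔥, ⁅a, y⁆ = 0) ∧
    (∀ (X : 𝔤) (a : 𝔥), t a = 0 → α X a = 0) ∧
    -- (ii) well-definedness of `η(t(x),t(y)) = [x,y]`
    (∀ x x' y y' : 𝔥, t x = t x' → t y = t y' → ⁅x, y⁆ = ⁅x', y'⁆) ∧
    -- (iii) & (iv) existence and uniqueness of the adjustment
    (∃ η : 𝔤 →ₗ[ℝ] 𝔤 →ₗ[ℝ] 𝔥,
      (∀ x y : 𝔥, η (t x) (t y) = ⁅x, y⁆) ∧
      (∀ X Y Z : 𝔤, η ⁅X, Y⁆ Z + η Y ⁅X, Z⁆ = η X ⁅Y, Z⁆) ∧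
      (∀ (x : 𝔥) (Y : 𝔤), η (t x) Y = - α Y x) ∧
      (∀ (X : 𝔤) (y : 𝔥), η X (t y) = α X y) ∧
      (∀ X Y : 𝔤, t (η X Y) = ⁅X, Y⁆) ∧
      (∀ η' : 𝔤 →ₗ[ℝ] 𝔤 →ₗ[ℝ] 𝔥,
        (∀ X Y Z : 𝔤, η' ⁅X, Y⁆ Z + η' Y ⁅X, Z⁆ = η' X ⁅Y, Z⁆) →
        (∀ (x : 𝔥) (Y : 𝔤), η' (t x) Y = - α Y x) →
        (∀ (X : 𝔤) (y : 𝔥), η' X (t y) = α X y) →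
        η' = η)) := by
  have h1 : ∀ a : 𝔥, t a = 0 → ∀ y : 𝔥, ⁅a, y⁆ = 0 := by
    intro a ha y
    rw [← hpeiffer, ha]; simp
  have h2 : ∀ (X : 𝔤) (a : 𝔥), t a = 0 → α X a = 0 := by
    intro X a ha
    obtain ⟨x, rfl⟩ := hsurj X
    rw [hpeiffer, ← lie_skew, h1 a ha, neg_zero]
  have h3 : ∀ x x' y y' : 𝔥, t x = t x' → t y = t y' → ⁅x, y⁆ = ⁅x', y'⁆ := by
    intro x x' y y' hx hy
    have e : α (t x') (y - y') = 0 := h2 _ _ (by rw [map_sub, hy, sub_self])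
    rw [map_sub, sub_eq_zero] at e
    rw [← hpeiffer, ← hpeiffer, hx, e]
  obtain ⟨s, hs⟩ := t.exists_rightInverse_of_surjective (LinearMap.range_eq_top.2 hsurj)
  have hs' : ∀ Y, t (s Y) = Y := fun Y => LinearMap.congr_fun hs Y
  let η : 𝔤 →ₗ[ℝ] 𝔤 →ₗ[ℝ] 𝔥 := α.compl₂ s
  have hη : ∀ x y : 𝔥, η (t x) (t y) = ⁅x, y⁆ := by
    intro x y
    change α (t x) (s (t y)) = _
    rw [hpeiffer]
    exact h3 _ _ _ _ rfl (hs' _)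
  refine ⟨h1, h2, h3, η, hη, ?_, ?_, ?_, ?_, ?_⟩
  · intro X Y Z
    obtain ⟨x, rfl⟩ := hsurj X
    obtain ⟨y, rfl⟩ := hsurj Y
    obtain ⟨z, rfl⟩ := hsurj Z
    simp only [← ht, hη]
    exact (leibniz_lie x y z).symm
  · intro x Y
    obtain ⟨y, rfl⟩ := hsurj Y
    rw [hη, hpeiffer, lie_skew]
  · intro X y
    obtain ⟨x, rfl⟩ := hsurj X
    rw [hη, hpeiffer]
  · intro X Y
    obtain ⟨x, rfl⟩ := hsurj X
    obtain ⟨y, rfl⟩ := hsurj Y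
    rw [hη, ht]
  · intro η' _ _ h
    ext X Y
    obtain ⟨x, rfl⟩ := hsurj X
    obtain ⟨y, rfl⟩ := hsurj Y
    rw [hη, h, hpeiffer]
end
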